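/- Let x₀ ∈ ℝ⁴, r₀ > 0 and A > 0. Let (u_i) be positive C² solutions of −Δu_i + h_i·u_i = 8u_i³ on the ball B(x₀, r₀), where |h_i| ≤ A. Suppose there are sequences R_i → 0 and c_i → +∞ with 4R_i < r₀ and R_i² · (sup_{B(x₀,R_i)} u_i)^{1/3} · (inf_{B(x₀,2R_i)} u_i) ≥ c_i for every i. Then, after passing to a subsequence, there exist points y_i → x₀ and positive reals l_i → 0, L_i → +∞ such that, setting M_i = u_i(y_i) and v_i(z) = u_i(y_i + z/M_i)/M_i, one has: (a) 0 < v_i(z) ≤ β_i for all |z| ≤ L_i, where β_i → 1; (b) v_i(z) → 1/(1+|z|²) uniformly on every compact subset of ℝ⁴; (c) l_i² · M_i^{1/3} · (inf_{B(x₀,2R_i)} u_i) → +∞. -/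

import Mathlib

open Filter Metric Topology

/-- The Euclidean Laplacian on ℝ⁴: `Δu(x) = ∑ i, ∂²u/∂x_i²`. -/
noncomputable def lap (u : EuclideanSpace ℝ (Fin 4) → ℝ) (x : EuclideanSpace ℝ (Fin 4)) : ℝ :=
  ∑ i : Fin 4, fderiv ℝ (fun y => fderiv ℝ u y (EuclideanSpace.single i 1)) x
    (EuclideanSpace.single i 1)

section

open MeasureTheory Set EuclideanGeometry

/-- Four-dimensional Euclidean space. -/
abbrev E4 : Type := EuclideanSpace ℝ (Fin 4)

lemma finrank_E4 : Module.finrank ℝ E4 = 4 := by simp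

/-- The radial function equal to `|y|⁻³` in the unit ball and to `|y|⁻⁶` outside of it. -/
noncomputable def decayKernel (y : E4) : ℝ :=
  if ‖y‖ < 1 then (‖y‖ ^ 3)⁻¹ else (‖y‖ ^ 6)⁻¹

lemma integrable_decayKernel : Integrable decayKernel := by
  have h := integrable_fun_norm_addHaar (volume : Measure E4)
    (f := fun r : ℝ => if r < 1 then (r ^ 3)⁻¹ else (r ^ 6)⁻¹)
  refine h.2 ?_
  rw [finrank_E4, ← Ioo_union_Ici_eq_Ioi (zero_lt_one' ℝ), integrableOn_union]
  constructor
  · have : IntegrableOn (fun _ : ℝ => (1 : ℝ)) (Ioo 0 1) := by simp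
    refine this.congr_fun ?_ measurableSet_Ioo
    intro r hr
    have := hr.1
    simp only [hr.2, if_true, smul_eq_mul]
    field_simp
  · rw [integrableOn_Ici_iff_integrableOn_Ioi]
    have : IntegrableOn (fun r : ℝ => r ^ (-3 : ℝ)) (Ioi 1) :=
      (integrableOn_Ioi_rpow_iff one_pos).2 (by norm_num)
    refine this.congr_fun ?_ measurableSet_Ioi
    intro r hr
    have h1 : ¬ r < 1 := not_lt.2 (le_of_lt hr)
    have : 0 < r := lt_trans one_pos hr
    simp only [h1, if_false, smul_eq_mul]
    rw [show (-3 : ℝ) = -((3 : ℕ) : ℝ) by norm_num, Real.rpow_neg this.le, Real.rpow_natCast]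
    field_simp

lemma decayKernel_nonneg (y : E4) : 0 ≤ decayKernel y := by
  unfold decayKernel; split_ifs <;> positivity

lemma decayKernel_of_lt {y : E4} (h : ‖y‖ < 1) : decayKernel y = (‖y‖ ^ 3)⁻¹ := by
  simp [decayKernel, h]

lemma decayKernel_of_le {y : E4} (h : 1 ≤ ‖y‖) : decayKernel y = (‖y‖ ^ 6)⁻¹ := by
  simp [decayKernel, not_lt.2 h]

lemma integrableOn_inv_norm_pow {r : ℝ} {k : ℕ} (hk : k ≤ 3) :
    IntegrableOn (fun y : E4 => (‖y‖ ^ k)⁻¹) (ball 0 r) := by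
  rw [integrableOn_fun_norm_addHaar volume (f := fun r : ℝ => (r ^ k)⁻¹)]
  have : IntegrableOn (fun s : ℝ => s ^ (3 - k)) (Ioo 0 r) :=
    ((continuous_pow (3 - k)).integrableOn_Icc (a := 0) (b := r)).mono_set Ioo_subset_Icc_self
  refine this.congr_fun ?_ measurableSet_Ioo
  intro s hs
  have := hs.1
  simp only [finrank_E4, smul_eq_mul]
  rw [pow_sub₀ _ this.ne' hk]

/-- The dimensional constant `8 ∫ (1 + |y|²)⁻³`, which is the area `4π²` of the normalized
fundamental solution `|y|⁻²`. -/
noncomputable def kap : ℝ := ∫ y : E4, 8 / (1 + ‖y‖ ^ 2) ^ 3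

lemma integrable_kap : Integrable (fun y : E4 => 8 / (1 + ‖y‖ ^ 2) ^ 3) := by
  have h := integrable_rpow_neg_one_add_norm_sq (E := E4) (μ := volume) (r := 6)
    (by simp; norm_num)
  refine (h.const_mul 8).congr (Eventually.of_forall fun y => ?_)
  have : (0 : ℝ) < 1 + ‖y‖ ^ 2 := by positivity
  simp only
  rw [show (-6 / 2 : ℝ) = -((3 : ℕ) : ℝ) by norm_num, Real.rpow_neg this.le, Real.rpow_natCast]
  rfl

lemma kap_pos : 0 < kap := by
  refine (integral_pos_iff_support_of_nonneg (fun y => by positivity) integrable_kap).2 ?_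
  have : Function.support (fun y : E4 => 8 / (1 + ‖y‖ ^ 2) ^ 3) = univ := by
    ext y; simp; positivity
  simp [this]

lemma norm_inversion_identity (x z y : E4) {l : ℝ} (hy : y ≠ x) :
    dist z (inversion x l y) ^ 2 * dist y x ^ 2 =
      l ^ 2 * dist z y ^ 2 + (dist z x ^ 2 - l ^ 2) * (dist y x ^ 2 - l ^ 2) := by
  have hyx : 0 < ‖y - x‖ := norm_pos_iff.2 (sub_ne_zero.2 hy)
  obtain ⟨q, rfl⟩ : ∃ q, y = x + q := ⟨y - x, by simp⟩
  obtain ⟨p, rfl⟩ : ∃ p, z = x + p := ⟨z - x, by simp⟩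
  simp only [inversion, dist_eq_norm, vsub_eq_sub, vadd_eq_add, add_sub_cancel_left] at *
  have h1 : x + p - ((l / ‖q‖) ^ 2 • q + x) = p - (l / ‖q‖) ^ 2 • q := by abel
  have h2 : x + p - (x + q) = p - q := by abel
  rw [h1, h2, norm_sub_sq_real, norm_sub_sq_real, inner_smul_right, norm_smul,
    Real.norm_of_nonneg (sq_nonneg (l / ‖q‖))]
  field_simp
  ring

lemma hasDerivAt_max_zero_pow (n : ℕ) (t : ℝ) :
    HasDerivAt (fun s : ℝ => max s 0 ^ (n + 2)) ((n + 2) * max t 0 ^ (n + 1)) t := by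
  rcases lt_trichotomy t 0 with h | h | h
  · have : (fun s : ℝ => max s 0 ^ (n + 2)) =ᶠ[𝓝 t] fun _ => 0 := by
      filter_upwards [gt_mem_nhds h] with s hs
      simp [max_eq_right hs.le]
    simpa [max_eq_right h.le] using (hasDerivAt_const t (0 : ℝ)).congr_of_eventuallyEq this
  · subst h
    rw [hasDerivAt_iff_isLittleO_nhds_zero]
    simp only [zero_add, max_self, ne_eq, Nat.add_eq_zero_iff, OfNat.ofNat_ne_zero, and_false,
      not_false_eq_true, zero_pow, sub_zero, one_ne_zero, mul_zero, smul_eq_mul]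
    have h1 : (fun s : ℝ => max s 0 ^ (n + 2)) =O[𝓝 0] fun s : ℝ => s ^ (n + 2) := by
      refine Asymptotics.IsBigO.of_bound 1 (Eventually.of_forall fun s => ?_)
      rw [one_mul, norm_pow, norm_pow]
      refine pow_le_pow_left₀ (norm_nonneg _) ?_ _
      rw [Real.norm_of_nonneg (le_max_right _ _)]
      exact max_le (le_abs_self s) (abs_nonneg s)
    have h2 : (fun s : ℝ => s ^ (n + 2)) =o[𝓝 0] fun s : ℝ => s := by
      simpa using Asymptotics.isLittleO_pow_pow (𝕜 := ℝ) (m := 1) (n := n + 2) (by omega)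
    exact h1.trans_isLittleO h2
  · have : (fun s : ℝ => max s 0 ^ (n + 2)) =ᶠ[𝓝 t] fun s => s ^ (n + 2) := by
      filter_upwards [lt_mem_nhds h] with s hs
      simp [max_eq_left hs.le]
    rw [max_eq_left h.le]
    have h3 := (hasDerivAt_pow (n + 2) t).congr_of_eventuallyEq this
    simpa using h3

lemma integrable_mul_of_continuousOn {f g : E4 → ℝ} {r L : ℝ} (hrL : r < L) (hf : Continuous f)
    (hf0 : ∀ y, r ≤ ‖y‖ → f y = 0) (hg : ContinuousOn g (ball 0 L)) :
    Integrable (fun y => f y * g y) := by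
  rw [← integrableOn_iff_integrable_of_support_subset (s := closedBall 0 r)]
  · exact (hf.continuousOn.mul (hg.mono (closedBall_subset_ball hrL))).integrableOn_compact
      (isCompact_closedBall 0 r)
  · intro y hy
    by_contra h
    apply hy
    have : r ≤ ‖y‖ := by
      simp only [mem_closedBall, dist_zero_right, not_le] at h
      exact h.le
    simp [hf0 y this]

lemma tsupport_subset_ball {f : E4 → ℝ} {r L : ℝ} (hrL : r < L)
    (hf0 : ∀ y, r ≤ ‖y‖ → f y = 0) : tsupport f ⊆ ball 0 L := by
  refine (closure_minimal ?_ isClosed_closedBall).trans (closedBall_subset_ball (x := 0) hrL)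
  intro y hy
  by_contra h
  simp only [mem_closedBall, dist_zero_right, not_le] at h
  exact hy (hf0 y h.le)

lemma hasFDerivAt_comp_norm_sq {F : ℝ → ℝ} {F' : ℝ} {y : E4} (h : HasDerivAt F F' (‖y‖ ^ 2)) :
    HasFDerivAt (fun y : E4 => F (‖y‖ ^ 2)) (F' • (2 : ℝ) • innerSL ℝ y) y := by
  have := h.comp_hasFDerivAt y (hasFDerivAt_id y).norm_sq
  refine this.congr_fderiv ?_
  ext v
  simp

/-- Green's identity against a compactly supported radial function. -/
lemma integral_radial_mul_lap {F F1 F2 : ℝ → ℝ} {r L : ℝ} (hrL : r < L)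
    (hF : ∀ s, 0 ≤ s → HasDerivAt F (F1 s) s) (hF1 : ∀ s, 0 ≤ s → HasDerivAt F1 (F2 s) s)
    (hF2 : Continuous fun y : E4 => F2 (‖y‖ ^ 2))
    (hF0 : ∀ y : E4, r ≤ ‖y‖ → F (‖y‖ ^ 2) = 0) (hF10 : ∀ y : E4, r ≤ ‖y‖ → F1 (‖y‖ ^ 2) = 0)
    (hF20 : ∀ y : E4, r ≤ ‖y‖ → F2 (‖y‖ ^ 2) = 0)
    {V : E4 → ℝ} (hV : ContDiffOn ℝ 2 V (ball 0 L)) :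
    ∫ y, F (‖y‖ ^ 2) * lap V y =
      ∫ y : E4, (4 * ‖y‖ ^ 2 * F2 (‖y‖ ^ 2) + 8 * F1 (‖y‖ ^ 2)) * V y := by
  have hFd : ∀ y : E4, HasFDerivAt (fun y : E4 => F (‖y‖ ^ 2))
      (F1 (‖y‖ ^ 2) • (2 : ℝ) • innerSL ℝ y) y := fun y =>
    hasFDerivAt_comp_norm_sq (hF _ (sq_nonneg _))
  have hF1d : ∀ y : E4, HasFDerivAt (fun y : E4 => F1 (‖y‖ ^ 2))
      (F2 (‖y‖ ^ 2) • (2 : ℝ) • innerSL ℝ y) y := fun y =>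
    hasFDerivAt_comp_norm_sq (hF1 _ (sq_nonneg _))
  have hFc : Continuous fun y : E4 => F (‖y‖ ^ 2) :=
    continuous_iff_continuousAt.2 fun y => (hFd y).continuousAt
  have hF1c : Continuous fun y : E4 => F1 (‖y‖ ^ 2) :=
    continuous_iff_continuousAt.2 fun y => (hF1d y).continuousAt
  set e : Fin 4 → E4 := fun i => EuclideanSpace.single i 1 with he
  have hin : ∀ (y : E4) i, inner ℝ y (e i) = y i := fun y i => by
    simp [he, EuclideanSpace.inner_single_right]
  set P : Fin 4 → E4 → ℝ := fun i y => 2 * F1 (‖y‖ ^ 2) * y i with hP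
  set Q : Fin 4 → E4 → ℝ := fun i y => 4 * F2 (‖y‖ ^ 2) * (y i) ^ 2 + 2 * F1 (‖y‖ ^ 2) with hQ
  have hcoord : ∀ i : Fin 4, Continuous fun y : E4 => y i := fun i => by fun_prop
  have hPc : ∀ i, Continuous (P i) := fun i => (continuous_const.mul hF1c).mul (hcoord i)
  have hQc : ∀ i, Continuous (Q i) := fun i =>
    ((continuous_const.mul hF2).mul ((hcoord i).pow 2)).add (continuous_const.mul hF1c)
  have hP0 : ∀ i y, r ≤ ‖y‖ → P i y = 0 := fun i y h => by simp [hP, hF10 y h]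
  have hQ0 : ∀ i y, r ≤ ‖y‖ → Q i y = 0 := fun i y h => by simp [hQ, hF10 y h, hF20 y h]
  have hdF : ∀ i y, fderiv ℝ (fun y : E4 => F (‖y‖ ^ 2)) y (e i) = P i y := fun i y => by
    rw [(hFd y).fderiv]
    simp only [smul_apply, innerSL_apply_apply, hin, smul_eq_mul, hP]
    ring
  have hPd : ∀ i y, HasFDerivAt (P i) ((2 * F1 (‖y‖ ^ 2)) • (EuclideanSpace.proj i : E4 →L[ℝ] ℝ) +
      (y i) • ((2 : ℝ) • F2 (‖y‖ ^ 2) • (2 : ℝ) • innerSL ℝ y)) y := fun i y => by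
    have h1 := ((hF1d y).const_mul 2).mul (EuclideanSpace.proj (𝕜 := ℝ) i : E4 →L[ℝ] ℝ).hasFDerivAt
    exact h1
  have hdP : ∀ i y, fderiv ℝ (P i) y (e i) = Q i y := fun i y => by
    rw [(hPd i y).fderiv]
    have hpr : (EuclideanSpace.proj i : E4 →L[ℝ] ℝ) (e i) = 1 := by simp [he]
    simp only [smul_apply, add_apply, innerSL_apply_apply, hin, smul_eq_mul, hQ, hpr]
    ring
  have hB : IsOpen (ball (0 : E4) L) := isOpen_ball
  have hV1 : ContDiffOn ℝ 1 (fderiv ℝ V) (ball 0 L) := hV.fderiv_of_isOpen hB (by norm_num)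
  have hVi : ∀ i, ContDiffOn ℝ 1 (fun y => fderiv ℝ V y (e i)) (ball 0 L) := fun i =>
    hV1.clm_apply contDiffOn_const
  have hVii : ∀ i, ContinuousOn (fun y => fderiv ℝ (fun y => fderiv ℝ V y (e i)) y (e i))
      (ball 0 L) := fun i =>
    ((hVi i).continuousOn_fderiv_of_isOpen hB le_rfl).clm_apply continuousOn_const
  have hVd : ∀ y ∈ ball (0 : E4) L, DifferentiableAt ℝ V y := fun y hy =>
    (hV.contDiffAt (hB.mem_nhds hy)).differentiableAt (by norm_num)
  have hVid : ∀ i, ∀ y ∈ ball (0 : E4) L, DifferentiableAt ℝ (fun y => fderiv ℝ V y (e i)) y :=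
    fun i y hy => ((hVi i).contDiffAt (hB.mem_nhds hy)).differentiableAt (by norm_num)
  have key : ∀ i, ∫ y, F (‖y‖ ^ 2) * fderiv ℝ (fun y => fderiv ℝ V y (e i)) y (e i) =
      ∫ y, Q i y * V y := fun i => by
    rw [integral_mul_fderiv_eq_neg_fderiv_mul_of_integrable
      (f := fun y : E4 => F (‖y‖ ^ 2)) (g := fun y => fderiv ℝ V y (e i)) (v := e i)]
    · simp_rw [hdF]
      rw [integral_mul_fderiv_eq_neg_fderiv_mul_of_integrable, neg_neg]
      · simp_rw [hdP]
      · simp_rw [hdP]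
        exact integrable_mul_of_continuousOn hrL (hQc i) (hQ0 i) hV.continuousOn
      · exact integrable_mul_of_continuousOn hrL (hPc i) (hP0 i) (hVi i).continuousOn
      · exact integrable_mul_of_continuousOn hrL (hPc i) (hP0 i) hV.continuousOn
      · exact fun y _ => (hPd i y).differentiableAt
      · exact fun y hy => hVd y (tsupport_subset_ball hrL (hP0 i) hy)
    · simp_rw [hdF]
      exact integrable_mul_of_continuousOn hrL (hPc i) (hP0 i) (hVi i).continuousOn
    · exact integrable_mul_of_continuousOn hrL hFc hF0 (hVii i)
    · exact integrable_mul_of_continuousOn hrL hFc hF0 (hVi i).continuousOn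
    · exact fun y _ => (hFd y).differentiableAt
    · exact fun y hy => hVid i y (tsupport_subset_ball hrL hF0 hy)
  have hl : ∀ y, F (‖y‖ ^ 2) * lap V y =
      ∑ i, F (‖y‖ ^ 2) * fderiv ℝ (fun y => fderiv ℝ V y (e i)) y (e i) := fun y => by
    rw [lap, Finset.mul_sum]
  simp_rw [hl]
  rw [integral_finsetSum _ fun i _ => integrable_mul_of_continuousOn hrL hFc hF0 (hVii i)]
  simp_rw [key]
  rw [← integral_finsetSum _ fun i _ =>
    integrable_mul_of_continuousOn hrL (hQc i) (hQ0 i) hV.continuousOn]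
  congr 1
  ext y
  rw [← Finset.sum_mul]
  congr 1
  rw [EuclideanSpace.real_norm_sq_eq y]
  simp only [hQ, Fin.sum_univ_four, EuclideanSpace.real_norm_sq_eq]
  ring

lemma continuousOn_lap {V : E4 → ℝ} {s : Set E4} (hs : IsOpen s) (hV : ContDiffOn ℝ 2 V s) :
    ContinuousOn (lap V) s := by
  have hV1 : ContDiffOn ℝ 1 (fderiv ℝ V) s := hV.fderiv_of_isOpen hs (by norm_num)
  refine continuousOn_finsetSum _ fun i _ => ?_
  have : ContDiffOn ℝ 1 (fun y => fderiv ℝ V y (EuclideanSpace.single i 1)) s :=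
    hV1.clm_apply contDiffOn_const
  exact (this.continuousOn_fderiv_of_isOpen hs le_rfl).clm_apply continuousOn_const

/-- The truncation profile `(1 - |y|²/r²)₊`. -/
noncomputable def cutoff (r : ℝ) (y : E4) : ℝ := max (1 - ‖y‖ ^ 2 / r ^ 2) 0

/-- The compactly supported averaging kernel in the representation formula. -/
noncomputable def massKernel (r : ℝ) (y : E4) : ℝ := 24 / r ^ 4 * cutoff r y

/-- The truncated fundamental solution in the representation formula. -/
noncomputable def potKernel (r : ℝ) (y : E4) : ℝ := cutoff r y ^ 3 * (‖y‖ ^ 2)⁻¹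

lemma cutoff_nonneg (r : ℝ) (y : E4) : 0 ≤ cutoff r y := le_max_right _ _

lemma cutoff_le_one (r : ℝ) (y : E4) : cutoff r y ≤ 1 :=
  max_le (sub_le_self _ (by positivity)) zero_le_one

lemma cutoff_eq_zero {r : ℝ} (hr : 0 < r) {y : E4} (hy : r ≤ ‖y‖) : cutoff r y = 0 := by
  refine max_eq_right (sub_nonpos.2 ?_)
  rw [one_le_div (by positivity)]
  gcongr

lemma continuous_cutoff (r : ℝ) : Continuous (cutoff r) := by
  unfold cutoff
  fun_prop

lemma tendsto_integral_scaled_bubble {f : E4 → ℝ} {C : ℝ} (hfm : AEStronglyMeasurable f)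
    (hfC : ∀ y, |f y| ≤ C) (hf : ContinuousAt f 0) :
    Tendsto (fun e : ℝ => ∫ y, 8 * e ^ 2 * ((‖y‖ ^ 2 + e ^ 2)⁻¹) ^ 3 * f y) (𝓝[>] 0)
      (𝓝 (kap * f 0)) := by
  have hscale : ∀ e : ℝ, 0 < e → ∫ y, 8 * e ^ 2 * ((‖y‖ ^ 2 + e ^ 2)⁻¹) ^ 3 * f y =
      ∫ y : E4, 8 / (1 + ‖y‖ ^ 2) ^ 3 * f (e • y) := by
    intro e he
    have h := Measure.integral_comp_smul (volume : Measure E4)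
      (fun y => 8 * e ^ 2 * ((‖y‖ ^ 2 + e ^ 2)⁻¹) ^ 3 * f y) e
    rw [finrank_E4, abs_of_pos (by positivity : (0 : ℝ) < (e ^ 4)⁻¹), smul_eq_mul] at h
    have h2 : ∫ y, 8 * e ^ 2 * ((‖y‖ ^ 2 + e ^ 2)⁻¹) ^ 3 * f y = e ^ 4 *
      ∫ y : E4, 8 * e ^ 2 * ((‖e • y‖ ^ 2 + e ^ 2)⁻¹) ^ 3 * f (e • y) := by
      rw [h, ← mul_assoc, mul_inv_cancel₀ (by positivity), one_mul]
    rw [h2, ← integral_const_mul]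
    congr 1
    ext y
    rw [norm_smul, Real.norm_of_nonneg he.le]
    have : (e * ‖y‖) ^ 2 + e ^ 2 = e ^ 2 * (1 + ‖y‖ ^ 2) := by ring
    rw [this]
    have h3 : (0 : ℝ) < 1 + ‖y‖ ^ 2 := by positivity
    field_simp
  have hlim : Tendsto (fun e : ℝ => ∫ y : E4, 8 / (1 + ‖y‖ ^ 2) ^ 3 * f (e • y)) (𝓝[>] 0)
      (𝓝 (∫ y : E4, 8 / (1 + ‖y‖ ^ 2) ^ 3 * f 0)) := by
    refine tendsto_integral_filter_of_dominated_convergence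
      (fun y : E4 => 8 / (1 + ‖y‖ ^ 2) ^ 3 * C) ?_ ?_ (integrable_kap.mul_const C) ?_
    · filter_upwards [self_mem_nhdsWithin] with e he
      refine integrable_kap.aestronglyMeasurable.mul ?_
      exact hfm.comp_quasiMeasurePreserving
        (Measure.quasiMeasurePreserving_smul (volume : Measure E4) (ne_of_gt he))
    · refine Eventually.of_forall fun e => Eventually.of_forall fun y => ?_
      rw [norm_mul, Real.norm_of_nonneg (by positivity)]
      gcongr
      exact hfC _
    · refine Eventually.of_forall fun y => Tendsto.const_mul _ ?_
      have h1 : Tendsto (fun e : ℝ => e • y) (𝓝[>] 0) (𝓝 0) := by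
        have : Continuous fun e : ℝ => e • y := by fun_prop
        simpa using (this.tendsto 0).mono_left nhdsWithin_le_nhds
      exact hf.tendsto.comp h1
  rw [integral_mul_const] at hlim
  refine hlim.congr' ?_
  filter_upwards [self_mem_nhdsWithin] with e he
  exact (hscale e he).symm

lemma integrable_indicator_inv_sq (r C : ℝ) :
    Integrable ((ball (0 : E4) r).indicator fun y => C * (‖y‖ ^ 2)⁻¹) :=
  (integrable_indicator_iff measurableSet_ball).2
    ((integrableOn_inv_norm_pow (k := 2) (by norm_num)).const_mul C)

lemma ae_ne_zero : ∀ᵐ y : E4, y ≠ 0 := by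
  simp [ae_iff]

/-- The value of a `C²` function at the centre of a ball in terms of a weighted average and of a
truncated Newtonian potential of its Laplacian. -/
theorem representation_zero {V : E4 → ℝ} {r L : ℝ} (hr : 0 < r) (hrL : r < L)
    (hV : ContDiffOn ℝ 2 V (ball 0 L)) :
    kap * V 0 = (∫ y, massKernel r y * V y) - ∫ y, potKernel r y * lap V y := by
  have hlc := continuousOn_lap isOpen_ball hV
  have hVc := hV.continuousOn
  obtain ⟨C1, hC1⟩ := (isCompact_closedBall (0 : E4) r).exists_bound_of_continuousOn
    (hVc.mono (closedBall_subset_ball hrL))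
  obtain ⟨C2, hC2⟩ := (isCompact_closedBall (0 : E4) r).exists_bound_of_continuousOn
    (hlc.mono (closedBall_subset_ball hrL))
  have hC1' : ∀ y : E4, ‖y‖ < r → |V y| ≤ C1 := fun y hy => hC1 y (by simpa using hy.le)
  have hC2' : ∀ y : E4, ‖y‖ < r → |lap V y| ≤ C2 := fun y hy => hC2 y (by simpa using hy.le)
  have hC10 : 0 ≤ C1 := (abs_nonneg _).trans (hC1' 0 (by simpa))
  have hC20 : 0 ≤ C2 := (abs_nonneg _).trans (hC2' 0 (by simpa))
  set m := cutoff r with hm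
  have hmc : Continuous m := continuous_cutoff r
  have hm0 : ∀ y, 0 ≤ m y := cutoff_nonneg r
  have hm1 : ∀ y, m y ≤ 1 := cutoff_le_one r
  have hmz : ∀ y, r ≤ ‖y‖ → m y = 0 := fun y hy => cutoff_eq_zero hr hy
  have hbc : ∀ e : ℝ, 0 < e → Continuous fun y : E4 => (‖y‖ ^ 2 + e ^ 2)⁻¹ := fun e he => by
    refine Continuous.inv₀ (by fun_prop) fun y => ?_
    positivity
  have hgreen : ∀ e : ℝ, 0 < e → ∫ y, m y ^ 3 * (‖y‖ ^ 2 + e ^ 2)⁻¹ * lap V y =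
      (∫ y, 24 / r ^ 4 * m y * (‖y‖ ^ 2 * (‖y‖ ^ 2 + e ^ 2)⁻¹) * V y) -
      (∫ y, 24 / r ^ 2 * m y ^ 2 * (e ^ 2 * (‖y‖ ^ 2 + e ^ 2)⁻¹ ^ 2) * V y) -
      ∫ y, 8 * e ^ 2 * ((‖y‖ ^ 2 + e ^ 2)⁻¹) ^ 3 * (m y ^ 3 * V y) := by
    intro e he
    set M : ℝ → ℝ := fun s => max (1 - s / r ^ 2) 0 with hM
    have hMd : ∀ (n : ℕ) (s : ℝ), HasDerivAt (fun s => M s ^ (n + 2))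
        ((n + 2) * M s ^ (n + 1) * (-1 / r ^ 2)) s := fun n s => by
      have h1 : HasDerivAt (fun s : ℝ => 1 - s / r ^ 2) (-1 / r ^ 2) s := by
        have := ((hasDerivAt_id s).div_const (r ^ 2)).const_sub 1
        simpa [neg_div] using this
      exact (hasDerivAt_max_zero_pow n (1 - s / r ^ 2)).comp s h1
    have hM3 : ∀ s, HasDerivAt (fun s => M s ^ 3) (3 * M s ^ 2 * (-1 / r ^ 2)) s := fun s => by
      refine (hMd 1 s).congr_deriv ?_
      norm_num
    have hM2 : ∀ s, HasDerivAt (fun s => M s ^ 2) (2 * M s * (-1 / r ^ 2)) s := fun s => by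
      refine (hMd 0 s).congr_deriv ?_
      norm_num
    have hbd : ∀ s : ℝ, 0 ≤ s → HasDerivAt (fun s => (s + e ^ 2)⁻¹) (-((s + e ^ 2)⁻¹ ^ 2)) s :=
      fun s hs => by
      have h1 := ((hasDerivAt_id s).add_const (e ^ 2)).inv (by simp only [id]; positivity)
      refine h1.congr_deriv ?_
      simp only [id, inv_pow]
      ring
    have hG := integral_radial_mul_lap (F := fun s => M s ^ 3 * (s + e ^ 2)⁻¹)
      (F1 := fun s => -3 / r ^ 2 * M s ^ 2 * (s + e ^ 2)⁻¹ - M s ^ 3 * (s + e ^ 2)⁻¹ ^ 2)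
      (F2 := fun s => 6 / r ^ 4 * max (1 - s / r ^ 2) 0 * (s + e ^ 2)⁻¹ +
        6 / r ^ 2 * M s ^ 2 * (s + e ^ 2)⁻¹ ^ 2 + 2 * M s ^ 3 * (s + e ^ 2)⁻¹ ^ 3)
      hrL ?_ ?_ ?_ ?_ ?_ ?_ hV
    · refine hG.trans ?_
      rw [← integral_sub, ← integral_sub]
      · congr 1
        ext y
        have hMm : M (‖y‖ ^ 2) = m y := rfl
        have hmm : max (1 - ‖y‖ ^ 2 / r ^ 2) 0 = m y := rfl
        have hpos : 0 < ‖y‖ ^ 2 + e ^ 2 := by positivity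
        simp only [hMm, hmm]
        field_simp
        ring
      · refine (integrable_mul_of_continuousOn hrL ?_ ?_ hVc).sub
          (integrable_mul_of_continuousOn hrL ?_ ?_ hVc)
        · exact (continuous_const.mul hmc).mul ((by fun_prop : Continuous fun y : E4 => ‖y‖ ^ 2).mul
            (hbc e he))
        · intro y hy; simp [hmz y hy]
        · exact (continuous_const.mul (hmc.pow 2)).mul (continuous_const.mul ((hbc e he).pow 2))
        · intro y hy; simp [hmz y hy]
      · have := integrable_mul_of_continuousOn (f := fun y => 8 * e ^ 2 *
          ((‖y‖ ^ 2 + e ^ 2)⁻¹) ^ 3 * m y ^ 3) hrL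
          ((continuous_const.mul ((hbc e he).pow 3)).mul (hmc.pow 3))
          (fun y hy => by simp [hmz y hy]) hVc
        simpa only [mul_assoc] using this
      · refine (integrable_mul_of_continuousOn hrL ?_ ?_ hVc)
        · exact (continuous_const.mul hmc).mul ((by fun_prop : Continuous fun y : E4 => ‖y‖ ^ 2).mul
            (hbc e he))
        · intro y hy; simp [hmz y hy]
      · refine (integrable_mul_of_continuousOn hrL ?_ ?_ hVc)
        · exact (continuous_const.mul (hmc.pow 2)).mul (continuous_const.mul ((hbc e he).pow 2))
        · intro y hy; simp [hmz y hy]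
    · intro s hs
      refine ((hM3 s).fun_mul (hbd s hs)).congr_deriv ?_
      ring
    · intro s hs
      have h2 := ((hM2 s).const_mul (-3 / r ^ 2)).fun_mul (hbd s hs)
      have h3 := (hM3 s).fun_mul ((hbd s hs).fun_pow 2)
      refine (h2.fun_sub h3).congr_deriv ?_
      simp only [hM]
      push_cast
      ring
    · have h1 : Continuous fun y : E4 => (‖y‖ ^ 2 + e ^ 2)⁻¹ := hbc e he
      have h2 : Continuous fun y : E4 => M (‖y‖ ^ 2) := hmc
      exact (((continuous_const.mul h2).mul h1).add ((continuous_const.mul (h2.pow 2)).mul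
        (h1.pow 2))).add ((continuous_const.mul (h2.pow 3)).mul (h1.pow 3))
    all_goals
      intro y hy
      have h2 : M (‖y‖ ^ 2) = 0 := hmz y hy
      have h3 : max (1 - ‖y‖ ^ 2 / r ^ 2) 0 = 0 := hmz y hy
      simp [h2, h3]
  have hb_lim : ∀ y : E4, y ≠ 0 →
      Tendsto (fun e : ℝ => (‖y‖ ^ 2 + e ^ 2)⁻¹) (𝓝[>] 0) (𝓝 (‖y‖ ^ 2)⁻¹) := by
    intro y hy
    have h1 : ContinuousAt (fun e : ℝ => (‖y‖ ^ 2 + e ^ 2)⁻¹) 0 := by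
      refine ContinuousAt.inv₀ (by fun_prop) ?_
      have := norm_pos_iff.2 hy
      positivity
    simpa using h1.tendsto.mono_left nhdsWithin_le_nhds
  have he2 : Tendsto (fun e : ℝ => e ^ 2) (𝓝[>] 0) (𝓝 0) := by
    simpa using ((continuous_pow 2).tendsto (0 : ℝ)).mono_left nhdsWithin_le_nhds
  have hA : Tendsto (fun e : ℝ => ∫ y, m y ^ 3 * (‖y‖ ^ 2 + e ^ 2)⁻¹ * lap V y) (𝓝[>] 0)
      (𝓝 (∫ y, potKernel r y * lap V y)) := by
    refine tendsto_integral_filter_of_dominated_convergence _ ?_ ?_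
      (integrable_indicator_inv_sq r C2) ?_
    · filter_upwards [self_mem_nhdsWithin] with e he
      exact (integrable_mul_of_continuousOn hrL ((hmc.pow 3).mul (hbc e he))
        (fun y hy => by simp [hmz y hy]) hlc).aestronglyMeasurable
    · filter_upwards [self_mem_nhdsWithin] with e he
      filter_upwards [ae_ne_zero] with y hy
      have hy' := norm_pos_iff.2 hy
      by_cases hyr : ‖y‖ < r
      · rw [indicator_of_mem (by simpa using hyr), norm_mul, Real.norm_eq_abs (lap V y), mul_comm]
        have h0 := hm0 y
        refine mul_le_mul (hC2' y hyr) ?_ (norm_nonneg _) hC20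
        rw [Real.norm_of_nonneg (by positivity), ← one_mul (‖y‖ ^ 2)⁻¹]
        gcongr
        · exact pow_le_one₀ (hm0 y) (hm1 y)
        · nlinarith [sq_nonneg e]
      · rw [indicator_of_notMem (by simpa using hyr)]
        simp [hmz y (not_lt.1 hyr)]
    · filter_upwards [ae_ne_zero] with y hy
      exact ((hb_lim y hy).const_mul _).mul_const _
  have hB : Tendsto (fun e : ℝ => ∫ y, 24 / r ^ 4 * m y * (‖y‖ ^ 2 * (‖y‖ ^ 2 + e ^ 2)⁻¹) * V y)
      (𝓝[>] 0) (𝓝 (∫ y, massKernel r y * V y)) := by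
    refine tendsto_integral_filter_of_dominated_convergence
      ((ball (0 : E4) r).indicator fun y => 24 / r ^ 4 * C1) ?_ ?_ ?_ ?_
    · filter_upwards [self_mem_nhdsWithin] with e he
      refine (integrable_mul_of_continuousOn hrL ?_ ?_ hVc).aestronglyMeasurable
      · exact (continuous_const.mul hmc).mul ((by fun_prop : Continuous fun y : E4 => ‖y‖ ^ 2).mul
          (hbc e he))
      · intro y hy; simp [hmz y hy]
    · filter_upwards [self_mem_nhdsWithin] with e he
      refine Eventually.of_forall fun y => ?_
      by_cases hyr : ‖y‖ < r
      · rw [indicator_of_mem (by simpa using hyr), norm_mul, Real.norm_eq_abs (V y)]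
        have h0 := hm0 y
        have he' : 0 < e := he
        refine mul_le_mul ?_ (hC1' y hyr) (abs_nonneg _) (by positivity)
        rw [Real.norm_of_nonneg (by positivity), mul_assoc]
        refine mul_le_of_le_one_right (by positivity) ?_
        refine mul_le_one₀ (hm1 y) (by positivity) ?_
        rw [← div_eq_mul_inv, div_le_one (by positivity)]
        nlinarith
      · rw [indicator_of_notMem (by simpa using hyr)]
        simp [hmz y (not_lt.1 hyr)]
    · exact (integrable_indicator_iff measurableSet_ball).2 (integrableOn_const (by
        exact measure_ball_lt_top.ne))
    · filter_upwards [ae_ne_zero] with y hy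
      have hy' := norm_pos_iff.2 hy
      have := ((((hb_lim y hy).const_mul (‖y‖ ^ 2)).const_mul (24 / r ^ 4 * m y)).mul_const (V y))
      rwa [mul_inv_cancel₀ (by positivity), mul_one] at this
  have hC : Tendsto (fun e : ℝ => ∫ y, 24 / r ^ 2 * m y ^ 2 *
      (e ^ 2 * (‖y‖ ^ 2 + e ^ 2)⁻¹ ^ 2) * V y) (𝓝[>] 0) (𝓝 0) := by
    rw [show 𝓝 (0 : ℝ) = 𝓝 (∫ y : E4, (0 : ℝ)) by simp]
    refine tendsto_integral_filter_of_dominated_convergence _ ?_ ?_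
      (integrable_indicator_inv_sq r (24 / r ^ 2 * C1)) ?_
    · filter_upwards [self_mem_nhdsWithin] with e he
      refine (integrable_mul_of_continuousOn hrL ?_ ?_ hVc).aestronglyMeasurable
      · exact (continuous_const.mul (hmc.pow 2)).mul (continuous_const.mul ((hbc e he).pow 2))
      · intro y hy; simp [hmz y hy]
    · filter_upwards [self_mem_nhdsWithin] with e he
      filter_upwards [ae_ne_zero] with y hy
      have hy' := norm_pos_iff.2 hy
      have he' : 0 < e := he
      by_cases hyr : ‖y‖ < r
      · rw [indicator_of_mem (by simpa using hyr), norm_mul, Real.norm_eq_abs (V y)]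
        have h0 := hm0 y
        have h2 : e ^ 2 * (‖y‖ ^ 2 + e ^ 2)⁻¹ ^ 2 ≤ (‖y‖ ^ 2)⁻¹ := by
          rw [sq (‖y‖ ^ 2 + e ^ 2)⁻¹, ← mul_assoc, ← one_mul (‖y‖ ^ 2)⁻¹]
          gcongr
          · rw [← div_eq_mul_inv, div_le_one (by positivity)]
            nlinarith
          · nlinarith
        rw [Real.norm_of_nonneg (by positivity), mul_assoc, mul_right_comm, mul_assoc (24 / r ^ 2),
          mul_assoc (24 / r ^ 2)]
        refine mul_le_mul_of_nonneg_left ?_ (by positivity)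
        rw [mul_right_comm, mul_comm C1]
        refine mul_le_mul ?_ (hC1' y hyr) (abs_nonneg _) (by positivity)
        exact (mul_le_of_le_one_right (by positivity) (pow_le_one₀ (hm0 y) (hm1 y))).trans h2
      · rw [indicator_of_notMem (by simpa using hyr)]
        simp [hmz y (not_lt.1 hyr)]
    · filter_upwards [ae_ne_zero] with y hy
      have := ((he2.mul ((hb_lim y hy).pow 2)).const_mul (24 / r ^ 2 * m y ^ 2)).mul_const (V y)
      simpa using this
  have hD : Tendsto (fun e : ℝ => ∫ y, 8 * e ^ 2 * ((‖y‖ ^ 2 + e ^ 2)⁻¹) ^ 3 * (m y ^ 3 * V y))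
      (𝓝[>] 0) (𝓝 (kap * V 0)) := by
    have := tendsto_integral_scaled_bubble (f := fun y => m y ^ 3 * V y) (C := C1) ?_ ?_ ?_
    · simpa [hm, cutoff] using this
    · exact (integrable_mul_of_continuousOn hrL (hmc.pow 3)
        (fun y hy => by simp [hmz y hy]) hVc).aestronglyMeasurable
    · intro y
      by_cases hyr : ‖y‖ < r
      · have h0 := hm0 y
        rw [abs_mul, abs_of_nonneg (by positivity), mul_comm]
        exact (mul_le_of_le_one_right (abs_nonneg _) (pow_le_one₀ (hm0 y) (hm1 y))).trans
          (hC1' y hyr)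
      · simp [hmz y (not_lt.1 hyr), hC10]
    · exact (hmc.pow 3).continuousAt.mul (hVc.continuousAt
        (isOpen_ball.mem_nhds (mem_ball_self (hr.trans hrL))))
  have hlim := (hB.sub hC).sub hD
  have heq := tendsto_nhds_unique hA (hlim.congr' ?_)
  · rw [heq]; ring
  · filter_upwards [self_mem_nhdsWithin] with e he
    exact (hgreen e he).symm

lemma fderiv_comp_affine (V : E4 → ℝ) (x : E4) (b a : ℝ) (z e : E4) :
    fderiv ℝ (fun z => b * V (x + a • z)) z e = b * a * fderiv ℝ V (x + a • z) e := by
  have h1 : fderiv ℝ (fun z => b * V (x + a • z)) z =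
      b • fderiv ℝ (fun z => V (x + a • z)) z :=
    congrFun (fderiv_const_smul_field (𝕜 := ℝ) (f := fun z => V (x + a • z)) b) z
  have h2 : fderiv ℝ (fun z => V (x + a • z)) z = a • fderiv ℝ (fun z => V (x + z)) (a • z) :=
    fderiv_comp_smul (f := fun z => V (x + z)) (x := z) a
  rw [h1, h2, fderiv_comp_add_left]
  simp [mul_assoc]

lemma lap_comp_affine (V : E4 → ℝ) (x : E4) (b a : ℝ) (z : E4) :
    lap (fun z => b * V (x + a • z)) z = b * a ^ 2 * lap V (x + a • z) := by
  unfold lap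
  rw [Finset.mul_sum]
  refine Finset.sum_congr rfl fun i _ => ?_
  simp only [fderiv_comp_affine V]
  rw [fderiv_comp_affine (fun y => fderiv ℝ V y (EuclideanSpace.single i 1))]
  ring

theorem representation_at {V : E4 → ℝ} {r L : ℝ} (x : E4) (hr : 0 < r) (hrL : r < L)
    (hV : ContDiffOn ℝ 2 V (ball x L)) :
    kap * V x = (∫ y, massKernel r y * V (x + y)) - ∫ y, potKernel r y * lap V (x + y) := by
  have h1 : ContDiffOn ℝ 2 (fun z => V (x + z)) (ball 0 L) := by
    refine hV.comp (contDiff_const.add contDiff_id).contDiffOn ?_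
    intro y hy
    simpa using hy
  have h2 := representation_zero hr hrL h1
  have h3 : ∀ y, lap (fun z => V (x + z)) y = lap V (x + y) := by
    intro y
    have := lap_comp_affine V x 1 1 y
    simpa using this
  simpa [h3] using h2

lemma massKernel_nonneg (r : ℝ) (y : E4) : 0 ≤ massKernel r y :=
  mul_nonneg (by positivity) (cutoff_nonneg r y)

lemma potKernel_nonneg (r : ℝ) (y : E4) : 0 ≤ potKernel r y :=
  mul_nonneg (pow_nonneg (cutoff_nonneg r y) 3) (by positivity)

lemma massKernel_eq_zero {r : ℝ} (hr : 0 < r) {y : E4} (hy : r ≤ ‖y‖) : massKernel r y = 0 := by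
  simp [massKernel, cutoff_eq_zero hr hy]

lemma potKernel_eq_zero {r : ℝ} (hr : 0 < r) {y : E4} (hy : r ≤ ‖y‖) : potKernel r y = 0 := by
  simp [potKernel, cutoff_eq_zero hr hy]

lemma integrable_massKernel {r : ℝ} (hr : 0 < r) : Integrable (massKernel r) := by
  have := integrable_mul_of_continuousOn (f := massKernel r) (g := fun _ => 1) (lt_add_one r)
    (continuous_const.mul (continuous_cutoff r)) (fun y hy => massKernel_eq_zero hr hy)
    continuousOn_const
  simpa using this

lemma potKernel_le (r : ℝ) (y : E4) : potKernel r y ≤ (‖y‖ ^ 2)⁻¹ :=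
  mul_le_of_le_one_left (by positivity) (pow_le_one₀ (cutoff_nonneg r y) (cutoff_le_one r y))

lemma measurable_potKernel (r : ℝ) : Measurable (potKernel r) :=
  ((continuous_cutoff r).measurable.pow_const 3).mul (by fun_prop)

lemma integrable_potKernel {r : ℝ} (hr : 0 < r) : Integrable (potKernel r) := by
  refine (integrable_indicator_inv_sq r 1).mono' (measurable_potKernel r).aestronglyMeasurable
    (Eventually.of_forall fun y => ?_)
  rw [Real.norm_of_nonneg (potKernel_nonneg r y)]
  by_cases hy : ‖y‖ < r
  · rw [indicator_of_mem (by simpa using hy)]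
    simpa using potKernel_le r y
  · rw [potKernel_eq_zero hr (not_lt.1 hy)]
    exact indicator_nonneg (fun y _ => by positivity) y

lemma tendsto_integral_abs_translate_sub {k : E4 → ℝ} (hk : Integrable k) :
    Tendsto (fun h => ∫ y, |k (y + h) - k y|) (𝓝 0) (𝓝 0) := by
  let g : E4 → C(E4, E4) := fun h => ⟨fun y => y + h, by fun_prop⟩
  have hg : Continuous g := by
    apply ContinuousMap.continuous_of_continuous_uncurry
    exact continuous_snd.add continuous_fst
  have hgm : ∀ h, MeasurePreserving (g h) volume volume := fun h =>
    measurePreserving_add_right volume h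
  have hkL := memLp_one_iff_integrable.2 hk
  have h1 := Filter.Tendsto.compMeasurePreservingLp (μ := volume) (ν := volume) (p := 1)
    (f := fun _ : E4 => hkL.toLp k) (f₀ := hkL.toLp k) (g := g) (g₀ := g 0) (l := 𝓝 0)
    tendsto_const_nhds (hg.tendsto 0) hgm (hgm 0) (by simp)
  have h2 := tendsto_iff_norm_sub_tendsto_zero.1 h1
  refine h2.congr fun h => ?_
  rw [Lp.toLp_compMeasurePreserving, Lp.toLp_compMeasurePreserving, ← MemLp.toLp_sub,
    L1.norm_eq_integral_norm]
  refine integral_congr_ae ?_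
  filter_upwards [MemLp.coeFn_toLp ((hkL.comp_measurePreserving (hgm h)).sub
    (hkL.comp_measurePreserving (hgm 0)))] with y hy
  rw [hy]
  simp [g, Real.norm_eq_abs]

lemma exists_subseq_of_modulus {H : ℕ → E4 → ℝ} {C : ℝ} {ω : E4 → ℝ}
    (hb : ∀ i x, |H i x| ≤ C) (hω : Tendsto ω (𝓝 0) (𝓝 0))
    (hm : ∀ i x x', |H i x - H i x'| ≤ ω (x - x')) :
    ∃ φ : ℕ → ℕ, StrictMono φ ∧ ∃ w : E4 → ℝ, Continuous w ∧
      ∀ K : Set E4, IsCompact K → TendstoUniformlyOn (fun i => H (φ i)) w atTop K := by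
  let T : Set (E4 → ℝ) := {f | (∀ x, |f x| ≤ C) ∧ ∀ x x', |f x - f x'| ≤ ω (x - x')}
  have hTeq : ∀ x ε, 0 < ε → ∀ᶠ x' in 𝓝 x, ∀ f ∈ T, |f x - f x'| < ε := by
    intro x ε hε
    have h1 : Tendsto (fun x' => ω (x - x')) (𝓝 x) (𝓝 0) := by
      refine hω.comp ?_
      have : Continuous fun x' => x - x' := by fun_prop
      simpa using this.tendsto x
    filter_upwards [h1.eventually (gt_mem_nhds hε)] with x' hx' f hf
    exact (hf.2 x x').trans_lt hx'
  have hTc : ∀ f ∈ T, Continuous f := by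
    intro f hf
    rw [continuous_iff_continuousAt]
    intro x
    rw [ContinuousAt, Metric.tendsto_nhds]
    intro ε hε
    filter_upwards [hTeq x ε hε] with x' hx'
    rw [dist_comm, Real.dist_eq]
    exact hx' f hf
  let S : Set C(E4, ℝ) := {F | ⇑F ∈ T}
  have hS : IsCompact S := by
    refine ArzelaAscoli.isCompact_of_equicontinuous S ?_ ?_
    · have : ContinuousMap.toFun '' S = T := by
        ext f
        constructor
        · rintro ⟨F, hF, rfl⟩
          exact hF
        · intro hf
          exact ⟨⟨f, hTc f hf⟩, hf, rfl⟩
      rw [this]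
      refine (isCompact_univ_pi fun _ : E4 => isCompact_Icc (a := -C) (b := C)).of_isClosed_subset
        ?_ ?_
      · simp only [T, ofPred_and, ofPred_forall]
        refine IsClosed.inter ?_ ?_
        · exact isClosed_iInter fun x => isClosed_le (by fun_prop) continuous_const
        · exact isClosed_iInter fun x => isClosed_iInter fun x' =>
            isClosed_le (by fun_prop) continuous_const
      · intro f hf x _
        exact abs_le.1 (hf.1 x)
    · intro x
      rw [Metric.equicontinuousAt_iff_right]
      intro ε hε
      filter_upwards [hTeq x ε hε] with x' hx' F
      rw [Real.dist_eq]
      exact hx' _ F.2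
  have hHT : ∀ i, H i ∈ T := fun i => ⟨hb i, hm i⟩
  obtain ⟨w, _, φ, hφ, hw⟩ := hS.tendsto_subseq
    (x := fun i => (⟨H i, hTc _ (hHT i)⟩ : C(E4, ℝ))) hHT
  refine ⟨φ, hφ, w, w.continuous, fun K hK => ?_⟩
  exact ContinuousMap.tendsto_iff_forall_isCompact_tendstoUniformlyOn.1 hw K hK

lemma integrable_mul_translate {k G : E4 → ℝ} {B : ℝ} (hk : Integrable k) (hG : Measurable G)
    (hB : ∀ y, |G y| ≤ B) (x : E4) : Integrable (fun y => k y * G (x + y)) := by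
  refine hk.mul_bdd (c := B) (hG.comp (measurable_const_add x)).aestronglyMeasurable
    (Eventually.of_forall fun y => ?_)
  exact hB _

lemma abs_integral_mul_translate_le {k G : E4 → ℝ} {B : ℝ} (hk : Integrable k)
    (hB : ∀ y, |G y| ≤ B) (x : E4) :
    |∫ y, k y * G (x + y)| ≤ (∫ y, |k y|) * B := by
  rw [← integral_mul_const, ← Real.norm_eq_abs]
  refine norm_integral_le_of_norm_le (hk.abs.mul_const B) (Eventually.of_forall fun y => ?_)
  rw [Real.norm_eq_abs, abs_mul]
  exact mul_le_mul_of_nonneg_left (hB _) (abs_nonneg _)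

lemma abs_integral_mul_translate_sub_le {k G : E4 → ℝ} {B : ℝ} (hk : Integrable k)
    (hG : Measurable G) (hB : ∀ y, |G y| ≤ B) (x x' : E4) :
    |(∫ y, k y * G (x + y)) - ∫ y, k y * G (x' + y)| ≤
      (∫ y, |k (y + (x - x')) - k y|) * B := by
  have h1 : ∫ y, k y * G (x' + y) = ∫ y, k (y + (x - x')) * G (x + y) := by
    rw [← integral_add_right_eq_self _ (x - x')]
    congr 1
    ext y
    congr 2
    abel
  have hk' : Integrable (fun y => k (y + (x - x'))) := hk.comp_add_right _
  rw [h1, ← integral_sub (integrable_mul_translate hk hG hB x)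
    (integrable_mul_translate hk' hG hB x), ← integral_mul_const, ← Real.norm_eq_abs]
  refine norm_integral_le_of_norm_le ((hk'.sub hk).abs.mul_const B)
    (Eventually.of_forall fun y => ?_)
  rw [← sub_mul, Real.norm_eq_abs, abs_mul, abs_sub_comm]
  exact mul_le_mul_of_nonneg_left (hB _) (abs_nonneg _)

/-- Compactness for almost-solutions of `-Δv = 8v³` on exhausting balls, with values at most
`1 + o(1)`; the limit satisfies the truncated integral equation. -/
theorem exists_subseq_limit {v a : ℕ → E4 → ℝ} {L β ε : ℕ → ℝ} (hL : Tendsto L atTop atTop)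
    (hβ : Tendsto β atTop (𝓝 1)) (hε : Tendsto ε atTop (𝓝 0))
    (hC2 : ∀ i, ContDiffOn ℝ 2 (v i) (ball 0 (L i)))
    (hpos : ∀ i, ∀ z ∈ ball (0 : E4) (L i), 0 < v i z)
    (hle : ∀ i, ∀ z ∈ ball (0 : E4) (L i), v i z ≤ β i) (h0 : ∀ i, v i 0 = 1)
    (ha : ∀ i, ∀ z ∈ ball (0 : E4) (L i), |a i z| ≤ ε i)
    (heq : ∀ i, ∀ z ∈ ball (0 : E4) (L i), -lap (v i) z + a i z * v i z = 8 * v i z ^ 3) :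
    ∃ φ : ℕ → ℕ, StrictMono φ ∧ ∃ w : E4 → ℝ, Continuous w ∧ (∀ x, 0 ≤ w x) ∧ (∀ x, w x ≤ 1) ∧
      w 0 = 1 ∧
      (∀ r, 0 < r → ∀ x, kap * w x =
        (∫ y, massKernel r y * w (x + y)) + 8 * ∫ y, potKernel r y * w (x + y) ^ 3) ∧
      ∀ K : Set E4, IsCompact K → TendstoUniformlyOn (fun i => v (φ i)) w atTop K := by
  obtain ⟨B, hB⟩ : ∃ B, ∀ i, β i ≤ B := by
    obtain ⟨B, hB⟩ := hβ.bddAbove_range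
    exact ⟨B, fun i => hB ⟨i, rfl⟩⟩
  obtain ⟨D, hD⟩ : ∃ D, ∀ i, ε i ≤ D := by
    obtain ⟨B, hB⟩ := hε.bddAbove_range
    exact ⟨B, fun i => hB ⟨i, rfl⟩⟩
  set B' := max B 0 with hB'
  set D' := max D 0 with hD'
  have hB'0 : 0 ≤ B' := le_max_right _ _
  have hD'0 : 0 ≤ D' := le_max_right _ _
  let V : ℕ → E4 → ℝ := fun i => (ball 0 (L i)).indicator (v i)
  let F : ℕ → E4 → ℝ := fun i => (ball 0 (L i)).indicator fun z => -lap (v i) z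
  have hmeas : ∀ (s : Set E4) (f : E4 → ℝ), IsOpen s → ContinuousOn f s →
      Measurable (s.indicator f) := by
    intro s f hs hf
    classical
    have := hf.measurable_piecewise (g := fun _ => (0 : ℝ)) continuousOn_const hs.measurableSet
    rwa [← Set.piecewise_eq_indicator]
  have hVm : ∀ i, Measurable (V i) := fun i => hmeas _ _ isOpen_ball (hC2 i).continuousOn
  have hFm : ∀ i, Measurable (F i) := fun i => hmeas _ _ isOpen_ball
    (continuousOn_lap isOpen_ball (hC2 i)).neg
  have hVB : ∀ i y, |V i y| ≤ B' := by
    intro i y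
    by_cases hy : y ∈ ball (0 : E4) (L i)
    · simp only [V, indicator_of_mem hy]
      rw [abs_of_pos (hpos i y hy)]
      exact (hle i y hy).trans ((hB i).trans (le_max_left _ _))
    · simp only [V, indicator_of_notMem hy, abs_zero, hB'0]
  have hFeq : ∀ i y, y ∈ ball (0 : E4) (L i) → F i y = 8 * v i y ^ 3 - a i y * v i y := by
    intro i y hy
    simp only [F, indicator_of_mem hy]
    linarith [heq i y hy]
  set B2 := 8 * B' ^ 3 + D' * B' with hB2
  have hFB : ∀ i y, |F i y| ≤ B2 := by
    intro i y
    by_cases hy : y ∈ ball (0 : E4) (L i)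
    · rw [hFeq i y hy]
      have h1 : |v i y| ≤ B' := by
        have := hVB i y
        simpa only [V, indicator_of_mem hy] using this
      have h2 : |a i y| ≤ D' := (ha i y hy).trans ((hD i).trans (le_max_left _ _))
      refine (abs_sub _ _).trans ?_
      rw [abs_mul, abs_mul, abs_pow, abs_of_pos (by norm_num : (0 : ℝ) < 8), hB2]
      gcongr
    · simp only [F, indicator_of_notMem hy, abs_zero]
      positivity
  have hrep : ∀ r, 0 < r → ∀ i x, ‖x‖ + r < L i → kap * v i x =
      (∫ y, massKernel r y * V i (x + y)) + ∫ y, potKernel r y * F i (x + y) := by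
    intro r hr i x hx
    have hsub : ball x (L i - ‖x‖) ⊆ ball 0 (L i) := ball_subset_ball' (by simp)
    rw [representation_at (L := L i - ‖x‖) x hr (by linarith) ((hC2 i).mono hsub), sub_eq_add_neg,
      ← integral_neg]
    have key : ∀ y, ‖y‖ < r → x + y ∈ ball (0 : E4) (L i) := by
      intro y hy
      rw [mem_ball_zero_iff]
      linarith [norm_add_le x y]
    congr 1
    · congr 1; ext y
      rcases lt_or_ge ‖y‖ r with hy | hy
      · simp only [V, indicator_of_mem (key y hy)]
      · simp [massKernel_eq_zero hr hy]
    · congr 1; ext y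
      rcases lt_or_ge ‖y‖ r with hy | hy
      · simp only [F, indicator_of_mem (key y hy)]
        ring
      · simp [potKernel_eq_zero hr hy]
  let H : ℕ → E4 → ℝ := fun i x =>
    ((∫ y, massKernel 1 y * V i (x + y)) + ∫ y, potKernel 1 y * F i (x + y)) / kap
  have hm1 := integrable_massKernel one_pos
  have hp1 := integrable_potKernel one_pos
  have hHv : ∀ i x, ‖x‖ + 1 < L i → H i x = v i x := by
    intro i x hx
    simp only [H, ← hrep 1 one_pos i x hx]
    rw [mul_div_cancel_left₀ _ kap_pos.ne']
  obtain ⟨φ, hφ, w, hwc, hw⟩ := exists_subseq_of_modulus (H := H)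
    (C := ((∫ y, |massKernel 1 y|) * B' + (∫ y, |potKernel 1 y|) * B2) / kap)
    (ω := fun h => ((∫ y, |massKernel 1 (y + h) - massKernel 1 y|) * B' +
      (∫ y, |potKernel 1 (y + h) - potKernel 1 y|) * B2) / kap)
    (by
      intro i x
      simp only [H]
      rw [abs_div, abs_of_pos kap_pos]
      refine div_le_div_of_nonneg_right ((abs_add_le _ _).trans ?_) kap_pos.le
      exact add_le_add (abs_integral_mul_translate_le hm1 (hVB i) x)
        (abs_integral_mul_translate_le hp1 (hFB i) x))
    (by
      have h1 := (tendsto_integral_abs_translate_sub hm1).mul_const B'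
      have h2 := (tendsto_integral_abs_translate_sub hp1).mul_const B2
      simpa using (h1.add h2).div_const kap)
    (by
      intro i x x'
      simp only [H]
      rw [← sub_div, abs_div, abs_of_pos kap_pos]
      refine div_le_div_of_nonneg_right ?_ kap_pos.le
      rw [add_sub_add_comm]
      refine (abs_add_le _ _).trans ?_
      exact add_le_add (abs_integral_mul_translate_sub_le hm1 (hVm i) (hVB i) x x')
        (abs_integral_mul_translate_sub_le hp1 (hFm i) (hFB i) x x'))
  have hLφ : Tendsto (fun i => L (φ i)) atTop atTop := hL.comp hφ.tendsto_atTop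
  have hev : ∀ r : ℝ, ∀ᶠ i in atTop, r < L (φ i) := fun r => hLφ.eventually_gt_atTop r
  have hunif : ∀ K : Set E4, IsCompact K → TendstoUniformlyOn (fun i => v (φ i)) w atTop K := by
    intro K hK
    obtain ⟨r, hr⟩ := hK.isBounded.exists_norm_le
    refine (hw K hK).congr ?_
    filter_upwards [hev (r + 1)] with i hi x hx
    exact hHv _ _ (by linarith [hr x hx])
  have hlim : ∀ x, Tendsto (fun i => v (φ i) x) atTop (𝓝 (w x)) := fun x =>
    (hunif {x} isCompact_singleton).tendsto_at (mem_singleton x)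
  have hballev : ∀ x : E4, ∀ᶠ i in atTop, x ∈ ball (0 : E4) (L (φ i)) := by
    intro x
    filter_upwards [hev ‖x‖] with i hi
    simpa using hi
  refine ⟨φ, hφ, w, hwc, ?_, ?_, ?_, ?_, hunif⟩
  · intro x
    refine ge_of_tendsto (hlim x) ?_
    filter_upwards [hballev x] with i hi using (hpos _ _ hi).le
  · intro x
    refine le_of_tendsto_of_tendsto (hlim x) (hβ.comp hφ.tendsto_atTop) ?_
    filter_upwards [hballev x] with i hi using hle _ _ hi
  · refine tendsto_nhds_unique (hlim 0) ?_
    simp [h0]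
  · intro r hr x
    have hVlim : ∀ x, Tendsto (fun i => V (φ i) x) atTop (𝓝 (w x)) := by
      intro x
      refine (hlim x).congr' ?_
      filter_upwards [hballev x] with i hi
      simp only [V, indicator_of_mem hi]
    have hFlim : ∀ x, Tendsto (fun i => F (φ i) x) atTop (𝓝 (8 * w x ^ 3)) := by
      intro x
      have h1 : Tendsto (fun i => a (φ i) x) atTop (𝓝 0) := by
        refine squeeze_zero_norm' ?_ (hε.comp hφ.tendsto_atTop)
        filter_upwards [hballev x] with i hi using ha _ _ hi
      have h2 := ((hlim x).pow 3).const_mul 8 |>.sub (h1.mul (hlim x))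
      rw [zero_mul, sub_zero] at h2
      refine h2.congr' ?_
      filter_upwards [hballev x] with i hi
      rw [hFeq _ _ hi]
    have hdct : ∀ (k : E4 → ℝ) (G : ℕ → E4 → ℝ) (g : E4 → ℝ) (B : ℝ), Integrable k →
        (∀ i, Measurable (G i)) → (∀ i y, |G i y| ≤ B) →
        (∀ y, Tendsto (fun i => G i y) atTop (𝓝 (g y))) →
        Tendsto (fun i => ∫ y, k y * G i (x + y)) atTop (𝓝 (∫ y, k y * g (x + y))) := by
      intro k G g B hk hG hGB hGg
      refine tendsto_integral_of_dominated_convergence (fun y => |k y| * B)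
        (fun i => (integrable_mul_translate hk (hG i) (hGB i) x).aestronglyMeasurable)
        (hk.abs.mul_const B) (fun i => Eventually.of_forall fun y => ?_)
        (Eventually.of_forall fun y => (hGg _).const_mul _)
      rw [Real.norm_eq_abs, abs_mul]
      exact mul_le_mul_of_nonneg_left (hGB i _) (abs_nonneg _)
    have h1 := hdct (massKernel r) (fun i => V (φ i)) w B' (integrable_massKernel hr)
      (fun i => hVm _) (fun i => hVB _) hVlim
    have h2 := hdct (potKernel r) (fun i => F (φ i)) (fun x => 8 * w x ^ 3) B2
      (integrable_potKernel hr) (fun i => hFm _) (fun i => hFB _) hFlim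
    have h3 : Tendsto (fun i => kap * v (φ i) x) atTop (𝓝 ((∫ y, massKernel r y * w (x + y)) +
        ∫ y, potKernel r y * (8 * w (x + y) ^ 3))) := by
      refine (h1.add h2).congr' ?_
      filter_upwards [hev (‖x‖ + r)] with i hi
      exact (hrep r hr _ _ hi).symm
    rw [tendsto_nhds_unique ((hlim x).const_mul kap) h3, ← integral_const_mul]
    congr 2
    ext y
    ring

lemma integral_pos_of_pos_on_open {g : E4 → ℝ} (hg : Integrable g) {U : Set E4}
    (hU : IsOpen U) (hne : U.Nonempty) (p : E4) (h0 : ∀ y, y ≠ p → 0 ≤ g y)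
    (hpos : ∀ y ∈ U, y ≠ p → 0 < g y) :
    0 < ∫ y, g y := by
  have h2 : 0 ≤ᵐ[volume] g := by
    filter_upwards [compl_mem_ae_iff.2 (measure_singleton p)] with y hy using h0 y hy
  refine (integral_pos_iff_support_of_nonneg_ae h2 hg).2 ?_
  have h1 : 0 < volume (U \ {p}) := by
    rw [measure_sdiff_null (measure_singleton p)]
    exact hU.measure_pos volume hne
  exact h1.trans_le (measure_mono fun y hy => (hpos y hy.1 hy.2).ne')

/-- A continuous function with values in `[0, 1]` which solves the truncated integral equation
associated with `-Δw = 8w³` at all scales. -/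
structure IsLocalSol (w : E4 → ℝ) : Prop where
  cont : Continuous w
  nonneg : ∀ x, 0 ≤ w x
  le_one : ∀ x, w x ≤ 1
  at_zero : w 0 = 1
  eqn : ∀ r, 0 < r → ∀ x, kap * w x =
    (∫ y, massKernel r y * w (x + y)) + 8 * ∫ y, potKernel r y * w (x + y) ^ 3

/-- A positive continuous bounded solution of the integral equation
`κ w(x) = 8 ∫ w(y)³ / |x - y|²`. -/
structure IsSol (w : E4 → ℝ) : Prop where
  cont : Continuous w
  pos : ∀ x, 0 < w x
  le_one : ∀ x, w x ≤ 1
  int : ∀ x, Integrable fun y => w y ^ 3 * (dist x y ^ 2)⁻¹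
  eqn : ∀ x, kap * w x = 8 * ∫ y, w y ^ 3 * (dist x y ^ 2)⁻¹

lemma integral_massKernel {r : ℝ} (hr : 0 < r) : ∫ y, massKernel r y = kap := by
  have h := representation_zero (V := fun _ => 1) hr (lt_add_one r) contDiffOn_const
  have : ∀ y, lap (fun _ => 1) y = 0 := by
    intro y
    simp [lap]
  simpa [this] using h.symm

lemma massKernel_le {r : ℝ} (hr : 0 < r) (y : E4) (hy : y ≠ 0) :
    massKernel r y ≤ 24 / r ^ 2 * (‖y‖ ^ 2)⁻¹ := by
  have hy' : 0 < ‖y‖ := norm_pos_iff.2 hy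
  rcases lt_or_ge ‖y‖ r with h | h
  · have h1 : massKernel r y ≤ 24 / r ^ 4 := mul_le_of_le_one_right (by positivity)
      (cutoff_le_one r y)
    refine h1.trans ?_
    have : 24 / r ^ 4 = 24 / r ^ 2 * (r ^ 2)⁻¹ := by field_simp
    rw [this]
    gcongr
  · rw [massKernel_eq_zero hr h]
    positivity

lemma tendsto_potKernel (y : E4) : Tendsto (fun r => potKernel r y) atTop (𝓝 ((‖y‖ ^ 2)⁻¹)) := by
  have h1 : Tendsto (fun r : ℝ => ‖y‖ ^ 2 / r ^ 2) atTop (𝓝 0) :=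
    tendsto_const_nhds.div_atTop (tendsto_pow_atTop (by norm_num))
  have h2 : Tendsto (fun r : ℝ => max (1 - ‖y‖ ^ 2 / r ^ 2) 0) atTop (𝓝 (max (1 - 0) 0)) :=
    (tendsto_const_nhds.sub h1).max tendsto_const_nhds
  have h3 := (h2.pow 3).mul_const ((‖y‖ ^ 2)⁻¹)
  simp only [potKernel, cutoff]
  simpa using h3

lemma IsLocalSol.integrable {w : E4 → ℝ} (hw : IsLocalSol w) (x : E4) :
    Integrable fun y => w (x + y) ^ 3 * (‖y‖ ^ 2)⁻¹ := by
  have hnn : ∀ y, 0 ≤ w (x + y) ^ 3 * (‖y‖ ^ 2)⁻¹ := fun y =>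
    mul_nonneg (pow_nonneg (hw.nonneg _) _) (by positivity)
  have hwc := hw.cont
  have hmeas : Measurable fun y => w (x + y) ^ 3 * (‖y‖ ^ 2)⁻¹ := by fun_prop
  refine (aecover_ball (μ := volume) (x := (0 : E4)) tendsto_id).integrable_of_integral_norm_bounded
    (64 / 27 * kap) ?_ ?_
  · intro r
    refine ((integrableOn_inv_norm_pow (k := 2) (r := r) (by norm_num))).mono'
      hmeas.aestronglyMeasurable (Eventually.of_forall fun y => ?_)
    rw [Real.norm_of_nonneg (hnn y)]
    exact mul_le_of_le_one_left (by positivity) (pow_le_one₀ (hw.nonneg _) (hw.le_one _))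
  · filter_upwards [eventually_gt_atTop 0] with r hr
    have hr2 : 0 < 2 * r := by positivity
    have hint : Integrable fun y => potKernel (2 * r) y * w (x + y) ^ 3 :=
      integrable_mul_translate (integrable_potKernel hr2) (G := fun y => w y ^ 3) (B := 1)
        (by fun_prop) (fun y => by
          rw [abs_of_nonneg (pow_nonneg (hw.nonneg y) 3)]
          exact pow_le_one₀ (hw.nonneg y) (hw.le_one y)) x
    have h1 : ∫ y in ball (0 : E4) (id r), ‖w (x + y) ^ 3 * (‖y‖ ^ 2)⁻¹‖ ≤
        ∫ y in ball (0 : E4) (id r), 64 / 27 * (potKernel (2 * r) y * w (x + y) ^ 3) := by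
      refine integral_mono_of_nonneg (Eventually.of_forall fun y => norm_nonneg _)
        (hint.const_mul _).integrableOn ?_
      filter_upwards [ae_restrict_mem measurableSet_ball] with y hy
      rw [Real.norm_of_nonneg (hnn y)]
      have hy' : ‖y‖ < r := by simpa using hy
      have h2 : 3 / 4 ≤ cutoff (2 * r) y := by
        refine le_trans ?_ (le_max_left _ _)
        have : ‖y‖ ^ 2 / (2 * r) ^ 2 ≤ r ^ 2 / (2 * r) ^ 2 := by gcongr
        have h3 : r ^ 2 / (2 * r) ^ 2 = 1 / 4 := by field_simp; norm_num
        linarith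
      have h3 : (3 / 4 : ℝ) ^ 3 ≤ cutoff (2 * r) y ^ 3 := by gcongr
      have h4 := mul_le_mul_of_nonneg_right h3 (hnn y)
      unfold potKernel
      nlinarith
    have h2 : ∫ y in ball (0 : E4) (id r), 64 / 27 * (potKernel (2 * r) y * w (x + y) ^ 3) ≤
        ∫ y, 64 / 27 * (potKernel (2 * r) y * w (x + y) ^ 3) :=
      setIntegral_le_integral (hint.const_mul _) (Eventually.of_forall fun y =>
        mul_nonneg (by norm_num) (mul_nonneg (potKernel_nonneg _ _) (pow_nonneg (hw.nonneg _) _)))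
    have h3 := hw.eqn _ hr2 x
    have h4 : 0 ≤ ∫ y, massKernel (2 * r) y * w (x + y) :=
      integral_nonneg fun y => mul_nonneg (massKernel_nonneg _ _) (hw.nonneg _)
    have h5 : kap * w x ≤ kap := mul_le_of_le_one_right kap_pos.le (hw.le_one x)
    rw [integral_const_mul] at h1
    rw [integral_const_mul, integral_const_mul] at h2
    have := kap_pos
    linarith

lemma IsLocalSol.eqn_zero {w : E4 → ℝ} (hw : IsLocalSol w) (x : E4) :
    kap * w x = 8 * ∫ y, w (x + y) ^ 3 * (‖y‖ ^ 2)⁻¹ := by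
  have hwc := hw.cont
  have hint := hw.integrable x
  set G := ∫ y, w (x + y) ^ 3 * (‖y‖ ^ 2)⁻¹ with hG
  have h1 : Tendsto (fun r => ∫ y, potKernel r y * w (x + y) ^ 3) atTop (𝓝 G) := by
    refine tendsto_integral_filter_of_dominated_convergence _
      (Eventually.of_forall fun r => ?_) ?_ hint (Eventually.of_forall fun y => ?_)
    · exact ((measurable_potKernel r).mul (by fun_prop)).aestronglyMeasurable
    · refine Eventually.of_forall fun r => Eventually.of_forall fun y => ?_
      rw [Real.norm_of_nonneg (mul_nonneg (potKernel_nonneg _ _) (pow_nonneg (hw.nonneg _) _)),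
        mul_comm]
      exact mul_le_mul_of_nonneg_left (potKernel_le r y) (pow_nonneg (hw.nonneg _) _)
    · rw [mul_comm (w (x + y) ^ 3)]
      exact (tendsto_potKernel y).mul_const _
  have h2 : Tendsto (fun r => ∫ y, massKernel r y * w (x + y)) atTop (𝓝 (kap * w x - 8 * G)) := by
    refine (tendsto_const_nhds.sub (h1.const_mul 8)).congr' ?_
    filter_upwards [eventually_gt_atTop 0] with r hr
    rw [hw.eqn r hr x]
    ring
  have h3 : 0 ≤ kap * w x - 8 * G := ge_of_tendsto h2 (Eventually.of_forall fun r =>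
    integral_nonneg fun y => mul_nonneg (massKernel_nonneg _ _) (hw.nonneg _))
  have h4 : ∀ s, 0 < s → kap * w x - 8 * G ≤ s * kap := by
    intro s hs
    have h5 : Tendsto (fun r : ℝ => s * kap + s⁻¹ ^ 2 * (24 / r ^ 2 * G)) atTop
        (𝓝 (s * kap + s⁻¹ ^ 2 * (0 * G))) :=
      tendsto_const_nhds.add (((tendsto_const_nhds.div_atTop
        (tendsto_pow_atTop (by norm_num))).mul_const G).const_mul _)
    rw [zero_mul, mul_zero, add_zero] at h5
    refine le_of_tendsto_of_tendsto h2 h5 ?_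
    filter_upwards [eventually_gt_atTop 0] with r hr
    have hm := integrable_massKernel hr
    have h6 : ∫ y, massKernel r y * w (x + y) ≤
        ∫ y, (s * massKernel r y +
          s⁻¹ ^ 2 * (24 / r ^ 2 * (w (x + y) ^ 3 * (‖y‖ ^ 2)⁻¹))) := by
      refine integral_mono_ae ?_ ((hm.const_mul s).add ((hint.const_mul _).const_mul _)) ?_
      · exact integrable_mul_translate hm hwc.measurable (B := 1) (fun y => by
          rw [abs_of_nonneg (hw.nonneg y)]; exact hw.le_one y) x
      · filter_upwards [ae_ne_zero] with y hy
        have h7 := massKernel_le hr y hy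
        have h8 := massKernel_nonneg r y
        have hwn := hw.nonneg (x + y)
        set W := w (x + y)
        have h9 : W ≤ s + s⁻¹ ^ 2 * W ^ 3 := by
          rcases le_or_gt W s with h | h
          · have : 0 ≤ s⁻¹ ^ 2 * W ^ 3 := by positivity
            linarith
          · have : 1 ≤ s⁻¹ ^ 2 * W ^ 2 := by
              rw [← mul_pow]
              refine one_le_pow₀ ?_
              rw [inv_mul_eq_div, one_le_div hs]
              exact h.le
            nlinarith
        calc massKernel r y * W ≤ massKernel r y * (s + s⁻¹ ^ 2 * W ^ 3) := by gcongr
          _ = s * massKernel r y + s⁻¹ ^ 2 * (massKernel r y * W ^ 3) := by ring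
          _ ≤ s * massKernel r y + s⁻¹ ^ 2 * ((24 / r ^ 2 * (‖y‖ ^ 2)⁻¹) * W ^ 3) := by gcongr
          _ = _ := by ring
    rw [integral_add (hm.const_mul s) ((hint.const_mul _).const_mul _), integral_const_mul,
      integral_const_mul, integral_const_mul, integral_massKernel hr] at h6
    exact h6
  have h5 : kap * w x - 8 * G ≤ 0 := by
    refine ge_of_tendsto (f := fun s : ℝ => s * kap) (x := 𝓝[>] 0) ?_ ?_
    · have : Tendsto (fun s : ℝ => s * kap) (𝓝 0) (𝓝 (0 * kap)) := tendsto_id.mul_const kap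
      rw [zero_mul] at this
      exact this.mono_left nhdsWithin_le_nhds
    · filter_upwards [self_mem_nhdsWithin] with s hs using h4 s hs
  linarith

theorem IsLocalSol.isSol {w : E4 → ℝ} (hw : IsLocalSol w) : IsSol w := by
  have hwc := hw.cont
  have hint : ∀ x, Integrable fun y => w y ^ 3 * (dist x y ^ 2)⁻¹ := by
    intro x
    have := (hw.integrable x).comp_add_left (-x)
    refine this.congr (Eventually.of_forall fun y => ?_)
    simp [dist_eq_norm, ← sub_eq_neg_add, norm_sub_rev x y]
  have heqn : ∀ x, kap * w x = 8 * ∫ y, w y ^ 3 * (dist x y ^ 2)⁻¹ := by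
    intro x
    rw [hw.eqn_zero x, ← integral_add_left_eq_self (fun y => w y ^ 3 * (dist x y ^ 2)⁻¹) x]
    simp
  refine ⟨hw.cont, fun x => ?_, hw.le_one, hint, heqn⟩
  have h1 : 0 < ∫ y, w y ^ 3 * (dist x y ^ 2)⁻¹ := by
    refine integral_pos_of_pos_on_open (hint x)
      (U := {y | 0 < w y}) (isOpen_lt continuous_const hwc)
      ⟨0, by simp [hw.at_zero]⟩ x
      (fun y _ => mul_nonneg (pow_nonneg (hw.nonneg y) 3) (by positivity)) fun y hy hyx => ?_
    have : 0 < dist x y := dist_pos.2 hyx.symm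
    have : 0 < w y := hy
    positivity
  have := heqn x
  have h2 : 0 < kap * w x := by rw [this]; positivity
  exact pos_of_mul_pos_right h2 kap_pos.le

lemma lap_bubble (x : E4) :
    lap (fun y : E4 => (1 + ‖y‖ ^ 2)⁻¹) x = -(8 * ((1 + ‖x‖ ^ 2)⁻¹) ^ 3) := by
  have hne : ∀ y : E4, 1 + ‖y‖ ^ 2 ≠ 0 := fun y => by positivity
  have h1 : ∀ (y e : E4), fderiv ℝ (fun y : E4 => (1 + ‖y‖ ^ 2)⁻¹) y e =
      -2 * inner ℝ y e * ((1 + ‖y‖ ^ 2)⁻¹) ^ 2 := by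
    intro y e
    have hd : HasDerivAt (fun s : ℝ => (1 + s)⁻¹) (-1 / (1 + ‖y‖ ^ 2) ^ 2) (‖y‖ ^ 2) :=
      ((hasDerivAt_id _).const_add 1).inv (hne y)
    rw [(hasFDerivAt_comp_norm_sq hd).fderiv]
    have := hne y
    simp
    field_simp
  have h2 : ∀ e : E4, fderiv ℝ (fun y : E4 => -2 * inner ℝ y e * ((1 + ‖y‖ ^ 2)⁻¹) ^ 2) x e =
      -2 * ‖e‖ ^ 2 * ((1 + ‖x‖ ^ 2)⁻¹) ^ 2 + 8 * inner ℝ x e ^ 2 * ((1 + ‖x‖ ^ 2)⁻¹) ^ 3 := by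
    intro e
    have hd : HasDerivAt (fun s : ℝ => ((1 + s)⁻¹) ^ 2)
        (2 * (1 + ‖x‖ ^ 2)⁻¹ * (-1 / (1 + ‖x‖ ^ 2) ^ 2)) (‖x‖ ^ 2) := by
      simpa using (((hasDerivAt_id _).const_add 1).fun_inv (hne x)).fun_pow 2
    have hi : HasFDerivAt (fun y : E4 => -2 * inner ℝ y e) ((-2 : ℝ) • innerSL ℝ e) x := by
      have := ((innerSL ℝ e).hasFDerivAt (x := x)).const_mul (-2)
      refine this.congr_of_eventuallyEq (Eventually.of_forall fun y => ?_)
      simp [real_inner_comm]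
    have := hi.fun_mul (hasFDerivAt_comp_norm_sq hd)
    rw [this.fderiv]
    have := hne x
    simp
    field_simp
    ring
  have hsum : ∑ i : Fin 4, inner ℝ x (EuclideanSpace.single i (1 : ℝ)) ^ 2 = ‖x‖ ^ 2 := by
    rw [EuclideanSpace.norm_sq_eq]
    simp [EuclideanSpace.inner_single_right]
  unfold lap
  simp only [h1, h2]
  rw [Finset.sum_add_distrib, ← Finset.sum_mul, ← Finset.sum_mul, ← Finset.mul_sum,
    ← Finset.mul_sum, hsum]
  have := hne x
  simp
  field_simp
  ring

lemma contDiff_bubble : ContDiff ℝ 2 (fun y : E4 => (1 + ‖y‖ ^ 2)⁻¹) :=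
  (contDiff_const.add (contDiff_norm_sq ℝ)).inv fun y => by positivity

lemma isSol_bubble : IsSol fun y : E4 => (1 + ‖y‖ ^ 2)⁻¹ := by
  refine IsLocalSol.isSol ⟨contDiff_bubble.continuous, fun x => by positivity, fun x => ?_,
    by simp, fun r hr x => ?_⟩
  · exact inv_le_one_of_one_le₀ (le_add_of_nonneg_right (by positivity))
  · rw [representation_at (V := fun y : E4 => (1 + ‖y‖ ^ 2)⁻¹) x hr (lt_add_one r)
      contDiff_bubble.contDiffOn, sub_eq_add_neg, ← integral_neg, ← integral_const_mul]
    congr 2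
    ext y
    rw [lap_bubble]
    ring

lemma IsSol.translate {w : E4 → ℝ} (hw : IsSol w) (x : E4) : IsSol fun y => w (x + y) := by
  have hwc := hw.cont
  have h : ∀ z y : E4, w (x + y) ^ 3 * (dist z y ^ 2)⁻¹ =
      (fun y => w y ^ 3 * (dist (x + z) y ^ 2)⁻¹) (x + y) := by
    intro z y
    simp
  refine ⟨by fun_prop, fun y => hw.pos _, fun y => hw.le_one _, fun z => ?_, fun z => ?_⟩
  · simp only [h]
    exact (hw.int (x + z)).comp_add_left x
  · simp only [h]
    rw [integral_add_left_eq_self (fun y => w y ^ 3 * (dist (x + z) y ^ 2)⁻¹) x]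
    exact hw.eqn _

/-- Inversion in the sphere of radius `l` centred at the origin. -/
noncomputable def sinv (l : ℝ) (y : E4) : E4 := (l / ‖y‖) ^ 2 • y

/-- The Kelvin transform with respect to the sphere of radius `l` centred at the origin. -/
noncomputable def kelvin (l : ℝ) (w : E4 → ℝ) (y : E4) : ℝ := (l / ‖y‖) ^ 2 * w (sinv l y)

lemma sinv_eq_inversion (l : ℝ) : sinv l = inversion 0 l := by
  ext1 y
  simp [sinv, inversion]

lemma norm_sinv {l : ℝ} (y : E4) : ‖sinv l y‖ = l ^ 2 / ‖y‖ := by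
  rcases eq_or_ne y 0 with rfl | hy
  · simp [sinv]
  have : ‖y‖ ≠ 0 := norm_ne_zero_iff.2 hy
  rw [sinv, norm_smul, Real.norm_of_nonneg (sq_nonneg _)]
  field_simp

lemma sinv_sinv {l : ℝ} (hl : 0 < l) (y : E4) : sinv l (sinv l y) = y := by
  rw [sinv_eq_inversion]
  exact inversion_inversion 0 hl.ne' y

lemma dist_sinv_sq {l : ℝ} (z : E4) {y : E4} (hy : y ≠ 0) :
    dist z (sinv l y) ^ 2 * ‖y‖ ^ 2 =
      l ^ 2 * dist z y ^ 2 + (‖z‖ ^ 2 - l ^ 2) * (‖y‖ ^ 2 - l ^ 2) := by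
  rw [sinv_eq_inversion]
  simpa using norm_inversion_identity 0 z y (l := l) hy

lemma measurable_sinv (l : ℝ) : Measurable (sinv l) := by
  unfold sinv
  fun_prop

lemma measurable_kelvin (l : ℝ) {w : E4 → ℝ} (hw : Continuous w) : Measurable (kelvin l w) := by
  have := hw.measurable.comp (measurable_sinv l)
  have h2 : Measurable fun y : E4 => (l / ‖y‖) ^ 2 := by fun_prop
  exact h2.mul this

lemma abs_det_fderiv_sinv {l : ℝ} (hl : 0 < l) {y : E4} :
    |(((l / dist y 0) ^ 2 • ((ℝ ∙ (y - 0))ᗮ.reflection : E4 →L[ℝ] E4)) : E4 →L[ℝ] E4).det| =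
      (l / ‖y‖) ^ 8 := by
  rw [ContinuousLinearMap.det, ContinuousLinearMap.toLinearMap_smul, LinearMap.det_smul, finrank_E4, abs_mul]
  have : |LinearMap.det (((ℝ ∙ (y - 0))ᗮ.reflection : E4 →L[ℝ] E4) : E4 →ₗ[ℝ] E4)| = 1 := by
    have := Submodule.det_reflection ((ℝ ∙ (y - 0))ᗮ)
    refine (congrArg abs this).trans ?_
    simp
  rw [this, mul_one, ← pow_mul, dist_zero_right, abs_of_nonneg (by positivity)]

lemma image_sinv {l : ℝ} (hl : 0 < l) : sinv l '' {y | l < ‖y‖} = ball 0 l \ {0} := by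
  ext z
  constructor
  · rintro ⟨y, hy, rfl⟩
    have hy0 : 0 < ‖y‖ := hl.trans hy
    have h1 : 0 < ‖sinv l y‖ := by rw [norm_sinv]; positivity
    refine ⟨?_, norm_pos_iff.1 h1⟩
    rw [mem_ball_zero_iff, norm_sinv, div_lt_iff₀ hy0, sq]
    exact mul_lt_mul_of_pos_left hy hl
  · rintro ⟨hz, hz0⟩
    have hz0 : 0 < ‖z‖ := norm_pos_iff.2 hz0
    rw [mem_ball_zero_iff] at hz
    refine ⟨sinv l z, ?_, sinv_sinv hl z⟩
    rw [mem_ofPred_eq, norm_sinv, lt_div_iff₀ hz0, sq]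
    exact mul_lt_mul_of_pos_left hz hl

lemma integral_split_sphere {F : E4 → ℝ} {l : ℝ} (hl : 0 < l) (hF : Integrable F) :
    IntegrableOn (fun y => (l / ‖y‖) ^ 8 * F (sinv l y)) {y | l < ‖y‖} ∧
    ∫ y, F y = (∫ y in {y | l < ‖y‖}, F y) +
      ∫ y in {y | l < ‖y‖}, (l / ‖y‖) ^ 8 * F (sinv l y) := by
  have hS : MeasurableSet {y : E4 | l < ‖y‖} := measurableSet_lt measurable_const measurable_norm
  have hd : ∀ y ∈ {y : E4 | l < ‖y‖}, HasFDerivWithinAt (sinv l)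
      ((l / dist y 0) ^ 2 • ((ℝ ∙ (y - 0))ᗮ.reflection : E4 →L[ℝ] E4)) {y | l < ‖y‖} y := by
    intro y hy
    have hy0 : y ≠ 0 := norm_pos_iff.1 (hl.trans hy)
    rw [sinv_eq_inversion]
    exact (hasFDerivAt_inversion hy0).hasFDerivWithinAt
  have hinj : InjOn (sinv l) {y | l < ‖y‖} := fun a _ b _ hab => by
    rw [← sinv_sinv hl a, hab, sinv_sinv hl]
  have h1 := integral_image_eq_integral_abs_det_fderiv_smul volume hS hd hinj F
  have h2 := integrableOn_image_iff_integrableOn_abs_det_fderiv_smul volume hS hd hinj F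
  simp only [abs_det_fderiv_sinv hl, smul_eq_mul, image_sinv hl] at h1 h2
  refine ⟨h2.1 hF.integrableOn, ?_⟩
  rw [← h1, ← integral_add_compl hS hF]
  congr 1
  refine setIntegral_congr_set ?_
  have h3 : (ball (0 : E4) l \ {0} : Set E4) =ᵐ[volume] closedBall 0 l := by
    refine (sdiff_null_ae_eq_self (measure_singleton _)).trans ?_
    refine ae_eq_of_subset_of_measure_ge ball_subset_closedBall ?_ measurableSet_ball.nullMeasurableSet
      measure_closedBall_lt_top.ne
    rw [Measure.addHaar_closedBall_eq_addHaar_ball]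
  refine EventuallyEq.trans ?_ h3.symm
  refine EventuallyEq.of_eq (Set.ext fun y => ?_)
  simp

/-- The reflected kernel of the moving sphere method. -/
noncomputable def reflKernel (l : ℝ) (z y : E4) : ℝ :=
  l ^ 2 * (l ^ 2 * dist z y ^ 2 + (‖z‖ ^ 2 - l ^ 2) * (‖y‖ ^ 2 - l ^ 2))⁻¹

lemma reflKernel_nonneg {l : ℝ} (hl : 0 < l) {z y : E4} (hz : l < ‖z‖) (hy : l < ‖y‖) :
    0 ≤ reflKernel l z y := by
  have h1 : 0 < ‖z‖ ^ 2 - l ^ 2 := by nlinarith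
  have h2 : 0 < ‖y‖ ^ 2 - l ^ 2 := by nlinarith
  unfold reflKernel
  positivity

lemma reflKernel_lt {l : ℝ} (hl : 0 < l) {z y : E4} (hz : l < ‖z‖) (hy : l < ‖y‖) (hzy : y ≠ z) :
    reflKernel l z y < (dist z y ^ 2)⁻¹ := by
  have h1 : 0 < ‖z‖ ^ 2 - l ^ 2 := by nlinarith
  have h2 : 0 < ‖y‖ ^ 2 - l ^ 2 := by nlinarith
  have h3 : 0 < dist z y := dist_pos.2 hzy.symm
  have h4 := mul_pos h1 h2
  unfold reflKernel
  rw [← div_eq_mul_inv, ← one_div, div_lt_div_iff₀ (by positivity) (by positivity)]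
  nlinarith

lemma IsSol.kelvin_identities {w : E4 → ℝ} (hw : IsSol w) {l : ℝ} (hl : 0 < l) {z : E4}
    (hz : l < ‖z‖) :
    (IntegrableOn (fun y => w y ^ 3 * (dist z y ^ 2)⁻¹) {y | l < ‖y‖} ∧
      IntegrableOn (fun y => kelvin l w y ^ 3 * reflKernel l z y) {y | l < ‖y‖} ∧
      kap * w z = 8 * ((∫ y in {y | l < ‖y‖}, w y ^ 3 * (dist z y ^ 2)⁻¹) +
        ∫ y in {y | l < ‖y‖}, kelvin l w y ^ 3 * reflKernel l z y)) ∧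
    (IntegrableOn (fun y => w y ^ 3 * reflKernel l z y) {y | l < ‖y‖} ∧
      IntegrableOn (fun y => kelvin l w y ^ 3 * (dist z y ^ 2)⁻¹) {y | l < ‖y‖} ∧
      kap * kelvin l w z = 8 * ((∫ y in {y | l < ‖y‖}, w y ^ 3 * reflKernel l z y) +
        ∫ y in {y | l < ‖y‖}, kelvin l w y ^ 3 * (dist z y ^ 2)⁻¹)) := by
  have hS : MeasurableSet {y : E4 | l < ‖y‖} := measurableSet_lt measurable_const measurable_norm
  have hz0 : 0 < ‖z‖ := hl.trans hz
  constructor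
  · have h := integral_split_sphere hl (hw.int z)
    have hc : ∀ y ∈ {y : E4 | l < ‖y‖},
        (l / ‖y‖) ^ 8 * (w (sinv l y) ^ 3 * (dist z (sinv l y) ^ 2)⁻¹) =
          kelvin l w y ^ 3 * reflKernel l z y := by
      intro y hy
      have hy0 : 0 < ‖y‖ := hl.trans hy
      unfold kelvin reflKernel
      rw [← dist_sinv_sq z (norm_pos_iff.1 hy0), mul_inv]
      field_simp
    exact ⟨(hw.int z).integrableOn, h.1.congr_fun hc hS, by
      rw [hw.eqn z, h.2, setIntegral_congr_fun hS hc]⟩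
  · have h := integral_split_sphere hl (hw.int (sinv l z))
    have hq : ∀ y, dist (sinv l z) y ^ 2 * ‖z‖ ^ 2 =
        l ^ 2 * dist z y ^ 2 + (‖z‖ ^ 2 - l ^ 2) * (‖y‖ ^ 2 - l ^ 2) := by
      intro y
      rw [dist_comm, dist_sinv_sq y (norm_pos_iff.1 hz0), dist_comm]
      ring
    have hc1 : ∀ y, (l / ‖z‖) ^ 2 * (w y ^ 3 * (dist (sinv l z) y ^ 2)⁻¹) =
        w y ^ 3 * reflKernel l z y := by
      intro y
      unfold reflKernel
      rw [← hq, mul_inv]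
      field_simp
    have hc2 : ∀ y ∈ {y : E4 | l < ‖y‖}, (l / ‖z‖) ^ 2 *
        ((l / ‖y‖) ^ 8 * (w (sinv l y) ^ 3 * (dist (sinv l z) (sinv l y) ^ 2)⁻¹)) =
          kelvin l w y ^ 3 * (dist z y ^ 2)⁻¹ := by
      intro y hy
      have hy0 : 0 < ‖y‖ := hl.trans hy
      have h1 : dist (sinv l z) (sinv l y) ^ 2 = dist z y ^ 2 * (l ^ 2 * (‖z‖ * ‖y‖)⁻¹) ^ 2 := by
        have h2 := hq (sinv l y)
        have h3 := dist_sinv_sq (l := l) z (norm_pos_iff.1 hy0)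
        rw [norm_sinv] at h2
        field_simp
        field_simp at h2
        linear_combination h2 + l ^ 2 * h3
      unfold kelvin
      rw [h1, mul_inv]
      field_simp
    have h1 : IntegrableOn (fun y => (l / ‖z‖) ^ 2 * (w y ^ 3 * (dist (sinv l z) y ^ 2)⁻¹))
        {y | l < ‖y‖} := ((hw.int (sinv l z)).const_mul _).integrableOn
    have h2 := h.1.const_mul ((l / ‖z‖) ^ 2)
    simp only [hc1] at h1
    refine ⟨h1, IntegrableOn.congr_fun h2 hc2 hS, ?_⟩
    have h3 : kap * kelvin l w z = (l / ‖z‖) ^ 2 * (kap * w (sinv l z)) := by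
      unfold kelvin; ring
    rw [h3, hw.eqn, h.2, mul_left_comm, mul_add, ← integral_const_mul, ← integral_const_mul,
      setIntegral_congr_fun hS hc2]
    simp only [hc1]

lemma IsSol.sub_kelvin {w : E4 → ℝ} (hw : IsSol w) {l : ℝ} (hl : 0 < l) {z : E4}
    (hz : l < ‖z‖) :
    IntegrableOn (fun y => ((dist z y ^ 2)⁻¹ - reflKernel l z y) * (w y ^ 3 - kelvin l w y ^ 3))
      {y | l < ‖y‖} ∧
    kap * (w z - kelvin l w z) = 8 * ∫ y in {y | l < ‖y‖},
      ((dist z y ^ 2)⁻¹ - reflKernel l z y) * (w y ^ 3 - kelvin l w y ^ 3) := by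
  obtain ⟨⟨h1, h2, h3⟩, h4, h5, h6⟩ := hw.kelvin_identities hl hz
  have h7 : ∀ y, ((dist z y ^ 2)⁻¹ - reflKernel l z y) * (w y ^ 3 - kelvin l w y ^ 3) =
      (w y ^ 3 * (dist z y ^ 2)⁻¹ + kelvin l w y ^ 3 * reflKernel l z y) -
        (w y ^ 3 * reflKernel l z y + kelvin l w y ^ 3 * (dist z y ^ 2)⁻¹) := fun y => by ring
  simp only [h7]
  refine ⟨(h1.add h2).sub (h4.add h5), ?_⟩
  have h8 := integral_sub (h1.add h2) (h4.add h5)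
  simp only [Pi.add_apply] at h8
  rw [h8, integral_add h1 h2, integral_add h4 h5]
  linear_combination h3 - h6

lemma IsSol.kelvin_pos {w : E4 → ℝ} (hw : IsSol w) {l : ℝ} (hl : 0 < l) {y : E4} (hy : y ≠ 0) :
    0 < kelvin l w y := by
  have := norm_pos_iff.2 hy
  exact mul_pos (by positivity) (hw.pos _)

lemma IsSol.kelvin_le {w : E4 → ℝ} (hw : IsSol w) {l : ℝ} {y : E4} :
    kelvin l w y ≤ (l / ‖y‖) ^ 2 :=
  mul_le_of_le_one_right (by positivity) (hw.le_one _)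

/-- If the region where the Kelvin transform exceeds `w` is small in a weighted sense, it is
empty. -/
lemma IsSol.kelvin_le_of_small {w : E4 → ℝ} (hw : IsSol w) {l : ℝ} (hl : 0 < l)
    (hint : ∀ z, l < ‖z‖ → Integrable ({y | l < ‖y‖ ∧ w y < kelvin l w y}.indicator
      fun y => (l / ‖y‖) ^ 4 * (dist z y ^ 2)⁻¹))
    (hsmall : ∀ z, l < ‖z‖ → 48 * ∫ y, {y | l < ‖y‖ ∧ w y < kelvin l w y}.indicator
      (fun y => (l / ‖y‖) ^ 4 * (dist z y ^ 2)⁻¹) y ≤ kap) :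
    ∀ y, l < ‖y‖ → kelvin l w y ≤ w y := by
  have hS : MeasurableSet {y : E4 | l < ‖y‖} := measurableSet_lt measurable_const measurable_norm
  set D := {y | l < ‖y‖ ∧ w y < kelvin l w y} with hD
  have hone : ∀ y : E4, l < ‖y‖ → l / ‖y‖ ≤ 1 := fun y hy => by
    rw [div_le_one (hl.trans hy)]
    exact hy.le
  have key : ∀ n : ℕ, ∀ z, l < ‖z‖ → kelvin l w z - w z ≤ (1 / 2) ^ n := by
    intro n
    induction n with
    | zero =>
      intro z hz
      have h1 := hw.kelvin_le (l := l) (y := z)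
      have h2 : (l / ‖z‖) ^ 2 ≤ 1 := pow_le_one₀ (by positivity) (hone z hz)
      have := hw.pos z
      simp only [pow_zero]
      linarith
    | succ n ih =>
      intro z hz
      set M : ℝ := (1 / 2) ^ n with hM
      have hM0 : 0 ≤ M := by positivity
      obtain ⟨h1, h2⟩ := hw.sub_kelvin hl hz
      have h3 : -∫ y in {y | l < ‖y‖},
          ((dist z y ^ 2)⁻¹ - reflKernel l z y) * (w y ^ 3 - kelvin l w y ^ 3) ≤
          ∫ y in {y | l < ‖y‖}, 3 * M * D.indicator
            (fun y => (l / ‖y‖) ^ 4 * (dist z y ^ 2)⁻¹) y := by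
        rw [← integral_neg]
        refine integral_mono_ae h1.neg ((hint z hz).const_mul _).integrableOn ?_
        have hne : ∀ᵐ y ∂(volume.restrict {y : E4 | l < ‖y‖}), y ≠ z :=
          ae_restrict_of_ae (by simp [ae_iff])
        filter_upwards [ae_restrict_mem hS, hne] with y hy hyz
        have hk0 := reflKernel_nonneg hl hz hy
        have hk1 := reflKernel_lt hl hz hy hyz
        have hwy := hw.pos y
        by_cases hyD : w y < kelvin l w y
        · rw [indicator_of_mem (show y ∈ D from ⟨hy, hyD⟩)]
          have hk := hw.kelvin_le (l := l) (y := y)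
          have h4 := ih y hy
          set t := l / ‖y‖
          set k := kelvin l w y
          set P := (dist z y ^ 2)⁻¹
          set Q := reflKernel l z y
          have ht0 : 0 ≤ t ^ 2 := by positivity
          have hkn : 0 ≤ k := hwy.le.trans hyD.le
          have h5 : k ^ 3 - w y ^ 3 ≤ 3 * M * t ^ 4 := by
            have h6 : k ^ 3 - w y ^ 3 = (k - w y) * (k ^ 2 + k * w y + w y ^ 2) := by ring
            have h7 : k ^ 2 + k * w y + w y ^ 2 ≤ 3 * t ^ 4 := by
              have : k ^ 2 ≤ (t ^ 2) ^ 2 := by gcongr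
              nlinarith
            rw [h6]
            calc (k - w y) * (k ^ 2 + k * w y + w y ^ 2) ≤ M * (3 * t ^ 4) := by
                  apply mul_le_mul h4 h7 (by nlinarith) hM0
              _ = _ := by ring
          have h8 : 0 ≤ k ^ 3 - w y ^ 3 := by
            have : w y ^ 3 ≤ k ^ 3 := by gcongr
            linarith
          calc -((P - Q) * (w y ^ 3 - k ^ 3)) = (P - Q) * (k ^ 3 - w y ^ 3) := by ring
            _ ≤ P * (k ^ 3 - w y ^ 3) := mul_le_mul_of_nonneg_right (by linarith) h8
            _ ≤ P * (3 * M * t ^ 4) := mul_le_mul_of_nonneg_left h5 (by linarith)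
            _ = _ := by ring
        · have h4 : 0 ≤ kelvin l w y := (hw.kelvin_pos hl (norm_pos_iff.1 (hl.trans hy))).le
          have h5 : kelvin l w y ^ 3 ≤ w y ^ 3 := by
            have := not_lt.1 hyD
            gcongr
          rw [indicator_of_notMem (fun h => hyD h.2), mul_zero]
          nlinarith
      have h4 : ∫ y in {y | l < ‖y‖}, 3 * M * D.indicator
            (fun y => (l / ‖y‖) ^ 4 * (dist z y ^ 2)⁻¹) y ≤
          ∫ y, 3 * M * D.indicator (fun y => (l / ‖y‖) ^ 4 * (dist z y ^ 2)⁻¹) y :=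
        setIntegral_le_integral ((hint z hz).const_mul _) (Eventually.of_forall fun y =>
          mul_nonneg (by positivity) (indicator_nonneg (fun y _ => by positivity) y))
      rw [integral_const_mul] at h3
      rw [integral_const_mul, integral_const_mul] at h4
      have h5 := hsmall z hz
      have h6 : kap * (kelvin l w z - w z) ≤ kap * (M / 2) := by nlinarith
      have := le_of_mul_le_mul_left h6 kap_pos
      rw [pow_succ]
      linarith
  intro y hy
  have h1 : Tendsto (fun n : ℕ => ((1 : ℝ) / 2) ^ n) atTop (𝓝 0) :=
    tendsto_pow_atTop_nhds_zero_of_lt_one (by norm_num) (by norm_num)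
  have := ge_of_tendsto h1 (Eventually.of_forall fun n => key n y hy)
  linarith

lemma mul_sq_le_cube_add_cube {X Y : ℝ} (hX : 0 ≤ X) (hY : 0 ≤ Y) : X * Y ^ 2 ≤ X ^ 3 + Y ^ 3 := by
  rcases le_total X Y with h | h
  · have : X * Y ^ 2 ≤ Y * Y ^ 2 := by gcongr
    have : 0 ≤ X ^ 3 := by positivity
    nlinarith
  · have : X * Y ^ 2 ≤ X * X ^ 2 := by gcongr
    have : 0 ≤ Y ^ 3 := by positivity
    nlinarith

lemma sq_mul_le_weighted {X Y s : ℝ} (hX : 0 ≤ X) (hY : 0 ≤ Y) (hs : 0 < s) (hs1 : s ≤ 1) :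
    X ^ 2 * Y ≤ s * Y ^ 3 + (s ^ 2)⁻¹ * X ^ 3 := by
  have h1 : (1 : ℝ) ≤ s⁻¹ := (one_le_inv₀ hs).2 hs1
  rcases le_total X (s * Y) with h | h
  · have : X ^ 2 * Y ≤ (s * Y) ^ 2 * Y := by gcongr
    have h2 : s ^ 2 * Y ^ 3 ≤ s * Y ^ 3 := by
      have : s ^ 2 ≤ s := by nlinarith
      gcongr
    have : 0 ≤ (s ^ 2)⁻¹ * X ^ 3 := by positivity
    nlinarith
  · have h2 : Y ≤ s⁻¹ * X := by
      rw [inv_mul_eq_div, le_div_iff₀ hs, mul_comm]; exact h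
    have h3 : X ^ 2 * Y ≤ X ^ 2 * (s⁻¹ * X) := by gcongr
    have h4 : s⁻¹ * X ^ 3 ≤ (s ^ 2)⁻¹ * X ^ 3 := by
      rw [← inv_pow]
      have : s⁻¹ ≤ s⁻¹ ^ 2 := by nlinarith
      gcongr
    have : 0 ≤ s * Y ^ 3 := by positivity
    nlinarith

lemma decayKernel_cases (y : E4) :
    (1 ≤ ‖y‖⁻¹ ∧ decayKernel y = ‖y‖⁻¹ ^ 3) ∨ (‖y‖⁻¹ ≤ 1 ∧ decayKernel y = ‖y‖⁻¹ ^ 6) := by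
  rcases eq_or_ne y 0 with rfl | hy
  · right
    simp [decayKernel]
  have h0 : 0 < ‖y‖ := norm_pos_iff.2 hy
  rcases lt_or_ge ‖y‖ 1 with h | h
  · left
    exact ⟨(one_le_inv₀ h0).2 h.le, by rw [decayKernel_of_lt h, inv_pow]⟩
  · right
    exact ⟨inv_le_one_of_one_le₀ h, by rw [decayKernel_of_le h, inv_pow]⟩

lemma kernel_le_small {l : ℝ} (hl : 0 < l) (hl1 : l ≤ 1) {y : E4} (u : E4) (hy : l < ‖y‖) :
    (l / ‖y‖) ^ 4 * (‖u‖ ^ 2)⁻¹ ≤ l * (decayKernel y + decayKernel u) := by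
  have ht : l / ‖y‖ ≤ 1 := by
    rw [div_le_one (hl.trans hy)]; exact hy.le
  have hX : 0 ≤ ‖y‖⁻¹ := by positivity
  have hY : 0 ≤ ‖u‖⁻¹ := by positivity
  have h1 : (l * ‖y‖⁻¹) ^ 4 ≤ l * ‖y‖⁻¹ := by
    rw [← div_eq_mul_inv]
    exact pow_le_of_le_one (by positivity) ht (by norm_num)
  have h2 : (l * ‖y‖⁻¹) ^ 4 ≤ l * ‖y‖⁻¹ ^ 4 := by
    rw [mul_pow]
    have : l ^ 4 ≤ l := pow_le_of_le_one hl.le hl1 (by norm_num)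
    gcongr
  rw [div_eq_mul_inv, ← inv_pow]
  set X := ‖y‖⁻¹
  set Y := ‖u‖⁻¹
  suffices h : ∃ T, (l * X) ^ 4 ≤ l * T ∧ T * Y ^ 2 ≤ decayKernel y + decayKernel u by
    obtain ⟨T, hT, h⟩ := h
    calc (l * X) ^ 4 * Y ^ 2 ≤ l * T * Y ^ 2 := by gcongr
      _ = l * (T * Y ^ 2) := by ring
      _ ≤ _ := by gcongr
  rcases decayKernel_cases y with ⟨hy1, hy2⟩ | ⟨hy1, hy2⟩ <;>
    rcases decayKernel_cases u with ⟨hu1, hu2⟩ | ⟨hu1, hu2⟩ <;> rw [hy2, hu2]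
  · exact ⟨X, h1, mul_sq_le_cube_add_cube hX hY⟩
  · refine ⟨X, h1, ?_⟩
    have h3 : X * Y ^ 2 ≤ X * 1 := by
      gcongr
      exact pow_le_one₀ hY hu1
    have h4 : X ≤ X ^ 3 := le_self_pow₀ hy1 (by norm_num)
    have : 0 ≤ Y ^ 6 := by positivity
    linarith
  · refine ⟨X ^ 4, h2, ?_⟩
    have h3 : X ^ 4 * Y ^ 2 ≤ 1 * Y ^ 2 := by
      gcongr
      exact pow_le_one₀ hX hy1
    have h4 : Y ^ 2 ≤ Y ^ 3 := pow_le_pow_right₀ hu1 (by norm_num)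
    have : 0 ≤ X ^ 6 := by positivity
    linarith
  · refine ⟨X ^ 4, h2, ?_⟩
    have := mul_sq_le_cube_add_cube (sq_nonneg Y) (sq_nonneg X)
    nlinarith

lemma kernel_le_near {l c s : ℝ} (hl : 0 < l) (hlc : l ≤ c) (hc : 1 ≤ c) (hs : 0 < s) (hs1 : s ≤ 1)
    {y : E4} (u : E4) (hy : l < ‖y‖) :
    (l / ‖y‖) ^ 4 * (‖u‖ ^ 2)⁻¹ ≤ c ^ 4 * (s * decayKernel u + (s ^ 2)⁻¹ * decayKernel y) := by
  have ht : l / ‖y‖ ≤ 1 := by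
    rw [div_le_one (hl.trans hy)]; exact hy.le
  have hX : 0 ≤ ‖y‖⁻¹ := by positivity
  have hY : 0 ≤ ‖u‖⁻¹ := by positivity
  have h1 : (l * ‖y‖⁻¹) ^ 4 ≤ c ^ 4 * 1 := by
    rw [← div_eq_mul_inv, mul_one]
    exact (pow_le_one₀ (by positivity) ht).trans (one_le_pow₀ hc)
  have h2 : (l * ‖y‖⁻¹) ^ 4 ≤ c ^ 4 * ‖y‖⁻¹ ^ 4 := by
    rw [mul_pow]
    gcongr
  have hs2 : 1 ≤ (s ^ 2)⁻¹ := (one_le_inv₀ (by positivity)).2 (pow_le_one₀ hs.le hs1)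
  rw [div_eq_mul_inv, ← inv_pow]
  set X := ‖y‖⁻¹
  set Y := ‖u‖⁻¹
  suffices h : ∃ T, (l * X) ^ 4 ≤ c ^ 4 * T ∧
      T * Y ^ 2 ≤ s * decayKernel u + (s ^ 2)⁻¹ * decayKernel y by
    obtain ⟨T, hT, h⟩ := h
    calc (l * X) ^ 4 * Y ^ 2 ≤ c ^ 4 * T * Y ^ 2 := by gcongr
      _ = c ^ 4 * (T * Y ^ 2) := by ring
      _ ≤ _ := by gcongr
  rcases decayKernel_cases y with ⟨hy1, hy2⟩ | ⟨hy1, hy2⟩ <;>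
    rcases decayKernel_cases u with ⟨hu1, hu2⟩ | ⟨hu1, hu2⟩ <;> rw [hy2, hu2]
  · refine ⟨1, h1, ?_⟩
    rw [one_mul]
    rcases le_total 1 (s * Y) with h | h
    · have h3 : Y ^ 2 * 1 ≤ Y ^ 2 * (s * Y) := by gcongr
      have : 0 ≤ (s ^ 2)⁻¹ * X ^ 3 := by positivity
      nlinarith
    · have h3 : Y ^ 2 ≤ (s ^ 2)⁻¹ := by
        rw [← inv_pow]
        have : Y ≤ s⁻¹ := by rwa [← one_div, le_div_iff₀ hs, mul_comm]
        gcongr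
      have h4 : (s ^ 2)⁻¹ * 1 ≤ (s ^ 2)⁻¹ * X ^ 3 := by
        gcongr
        exact one_le_pow₀ hy1
      have : 0 ≤ s * Y ^ 3 := by positivity
      linarith
  · refine ⟨1, h1, ?_⟩
    have h3 : Y ^ 2 ≤ 1 := pow_le_one₀ hY hu1
    have h4 : 1 * 1 ≤ (s ^ 2)⁻¹ * X ^ 3 := by
      gcongr
      exact one_le_pow₀ hy1
    have : 0 ≤ s * Y ^ 6 := by positivity
    linarith
  · refine ⟨X ^ 4, h2, ?_⟩
    rcases le_total (X ^ 4) (s * Y) with h | h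
    · have h3 : X ^ 4 * Y ^ 2 ≤ s * Y * Y ^ 2 := by gcongr
      have : 0 ≤ (s ^ 2)⁻¹ * X ^ 6 := by positivity
      nlinarith
    · have h3 : Y ≤ s⁻¹ * X ^ 4 := by
        rw [inv_mul_eq_div, le_div_iff₀ hs, mul_comm]; exact h
      have h4 : X ^ 4 * Y ^ 2 ≤ X ^ 4 * (s⁻¹ * X ^ 4) ^ 2 := by gcongr
      have h5 : X ^ 4 * (s⁻¹ * X ^ 4) ^ 2 = (s ^ 2)⁻¹ * X ^ 6 * X ^ 6 := by
        rw [← inv_pow]; ring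
      have h6 : (s ^ 2)⁻¹ * X ^ 6 * X ^ 6 ≤ (s ^ 2)⁻¹ * X ^ 6 * 1 := by
        gcongr
        exact pow_le_one₀ hX hy1
      have : 0 ≤ s * Y ^ 3 := by positivity
      linarith
  · refine ⟨X ^ 4, h2, ?_⟩
    have := sq_mul_le_weighted (sq_nonneg X) (sq_nonneg Y) hs hs1
    nlinarith

lemma measurableSet_lt_kelvin (l : ℝ) {w : E4 → ℝ} (hw : Continuous w) :
    MeasurableSet {y | l < ‖y‖ ∧ w y < kelvin l w y} :=
  (measurableSet_lt measurable_const measurable_norm).inter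
    (measurableSet_lt hw.measurable (measurable_kelvin l hw))

lemma integral_decayKernel_sub (z : E4) : ∫ y, decayKernel (z - y) = ∫ y, decayKernel y :=
  integral_sub_left_eq_self decayKernel volume z

lemma measurable_indicator_kernel (l : ℝ) {w : E4 → ℝ} (hw : Continuous w) (z : E4) :
    Measurable ({y | l < ‖y‖ ∧ w y < kelvin l w y}.indicator
      fun y => (l / ‖y‖) ^ 4 * (dist z y ^ 2)⁻¹) :=
  Measurable.indicator (by fun_prop) (measurableSet_lt_kelvin l hw)

lemma IsSol.exists_small {w : E4 → ℝ} (hw : IsSol w) :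
    ∃ l, 0 < l ∧ ∀ y, l < ‖y‖ → kelvin l w y ≤ w y := by
  set I := ∫ y, decayKernel y with hI
  have hI0 : 0 ≤ I := integral_nonneg decayKernel_nonneg
  have hk := kap_pos
  obtain ⟨l, hl, hl1, hl2⟩ : ∃ l, 0 < l ∧ l ≤ 1 ∧ l * (96 * (I + 1)) ≤ kap := by
    refine ⟨min 1 (kap / (96 * (I + 1))), lt_min one_pos (by positivity), min_le_left _ _, ?_⟩
    rw [← le_div_iff₀ (by positivity)]
    exact min_le_right _ _
  set D := {y | l < ‖y‖ ∧ w y < kelvin l w y} with hD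
  have hle : ∀ z y, D.indicator
      (fun y => (l / ‖y‖) ^ 4 * (dist z y ^ 2)⁻¹) y ≤
        l * (decayKernel y + decayKernel (z - y)) := by
    intro z y
    have := decayKernel_nonneg y
    have := decayKernel_nonneg (z - y)
    by_cases hy : y ∈ D
    · rw [indicator_of_mem hy, dist_eq_norm]
      exact kernel_le_small hl hl1 _ hy.1
    · rw [indicator_of_notMem hy]
      positivity
  have hnn : ∀ z y, 0 ≤ D.indicator
      (fun y => (l / ‖y‖) ^ 4 * (dist z y ^ 2)⁻¹) y :=
    fun z y => indicator_nonneg (fun y _ => by positivity) y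
  have hb : ∀ z, Integrable fun y => l * (decayKernel y + decayKernel (z - y)) := fun z =>
    (integrable_decayKernel.add (integrable_decayKernel.comp_sub_left z)).const_mul l
  have hint : ∀ z, Integrable (D.indicator
      fun y => (l / ‖y‖) ^ 4 * (dist z y ^ 2)⁻¹) := fun z =>
    (hb z).mono' (measurable_indicator_kernel l hw.cont z).aestronglyMeasurable
      (Eventually.of_forall fun y => by
        rw [Real.norm_of_nonneg (hnn z y)]; exact hle z y)
  refine ⟨l, hl, hw.kelvin_le_of_small hl (fun z _ => hint z) fun z _ => ?_⟩
  have h1 := integral_mono (hint z) (hb z) (hle z)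
  rw [integral_const_mul, integral_add integrable_decayKernel
    (integrable_decayKernel.comp_sub_left z), integral_decayKernel_sub] at h1
  nlinarith

lemma IsSol.kelvin_le_of_near {w : E4 → ℝ} (hw : IsSol w) {l c s : ℝ} (hl : 0 < l) (hlc : l ≤ c)
    (hc : 1 ≤ c) (hs : 0 < s) (hs1 : s ≤ 1)
    (h : 48 * (c ^ 4 * (s * (∫ y, decayKernel y) + (s ^ 2)⁻¹ *
      ∫ y, {y | l < ‖y‖ ∧ w y < kelvin l w y}.indicator decayKernel y)) ≤ kap) :
    ∀ y, l < ‖y‖ → kelvin l w y ≤ w y := by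
  set D := {y | l < ‖y‖ ∧ w y < kelvin l w y} with hD
  have hDm : MeasurableSet D := measurableSet_lt_kelvin l hw.cont
  have hle : ∀ z y, D.indicator (fun y => (l / ‖y‖) ^ 4 * (dist z y ^ 2)⁻¹) y ≤
        c ^ 4 * (s * decayKernel (z - y) + (s ^ 2)⁻¹ * D.indicator decayKernel y) := by
    intro z y
    have := decayKernel_nonneg (z - y)
    by_cases hy : y ∈ D
    · rw [indicator_of_mem hy, indicator_of_mem hy, dist_eq_norm]
      exact kernel_le_near hl hlc hc hs hs1 _ hy.1
    · rw [indicator_of_notMem hy, indicator_of_notMem hy]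
      positivity
  have hnn : ∀ z y, 0 ≤ D.indicator (fun y => (l / ‖y‖) ^ 4 * (dist z y ^ 2)⁻¹) y :=
    fun z y => indicator_nonneg (fun y _ => by positivity) y
  have hb1 : ∀ z, Integrable fun y => s * decayKernel (z - y) := fun z =>
    (integrable_decayKernel.comp_sub_left z).const_mul s
  have hb2 : Integrable fun y => (s ^ 2)⁻¹ * D.indicator decayKernel y :=
    (integrable_decayKernel.indicator hDm).const_mul _
  have hb : ∀ z, Integrable fun y =>
      c ^ 4 * (s * decayKernel (z - y) + (s ^ 2)⁻¹ * D.indicator decayKernel y) := fun z =>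
    ((hb1 z).add hb2).const_mul _
  have hint : ∀ z, Integrable (D.indicator fun y => (l / ‖y‖) ^ 4 * (dist z y ^ 2)⁻¹) := fun z =>
    (hb z).mono' (measurable_indicator_kernel l hw.cont z).aestronglyMeasurable
      (Eventually.of_forall fun y => by
        rw [Real.norm_of_nonneg (hnn z y)]; exact hle z y)
  refine hw.kelvin_le_of_small hl (fun z _ => hint z) fun z _ => ?_
  have h1 := integral_mono (hint z) (hb z) (hle z)
  rw [integral_const_mul, integral_add (hb1 z) hb2, integral_const_mul, integral_const_mul,
    integral_decayKernel_sub] at h1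
  linarith

lemma continuousAt_kelvin {w : E4 → ℝ} (hw : Continuous w) (l : ℝ) {y : E4} (hy : y ≠ 0) :
    ContinuousAt (kelvin l w) y := by
  have : ‖y‖ ≠ 0 := norm_ne_zero_iff.2 hy
  unfold kelvin sinv
  fun_prop (disch := assumption)

lemma continuous_kelvin_radius {w : E4 → ℝ} (hw : Continuous w) (y : E4) :
    Continuous fun l => kelvin l w y := by
  unfold kelvin sinv
  fun_prop

/-- Strong maximum principle for the difference of `w` and its Kelvin transform. -/
lemma IsSol.kelvin_lt {w : E4 → ℝ} (hw : IsSol w) {l : ℝ} (hl : 0 < l)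
    (hle : ∀ y, l < ‖y‖ → kelvin l w y ≤ w y) (hne : ∃ y, l < ‖y‖ ∧ kelvin l w y ≠ w y) {z : E4}
    (hz : l < ‖z‖) : kelvin l w z < w z := by
  have hS : IsOpen {y : E4 | l < ‖y‖} := isOpen_lt continuous_const continuous_norm
  obtain ⟨h1, h2⟩ := hw.sub_kelvin hl hz
  rw [← integral_indicator hS.measurableSet] at h2
  rw [← integrable_indicator_iff hS.measurableSet] at h1
  have hpos : 0 < ∫ y, {y : E4 | l < ‖y‖}.indicator (fun y =>
      ((dist z y ^ 2)⁻¹ - reflKernel l z y) * (w y ^ 3 - kelvin l w y ^ 3)) y := by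
    have hU : IsOpen ({y : E4 | l < ‖y‖} ∩ (fun y => w y - kelvin l w y) ⁻¹' Ioi 0) := by
      refine ContinuousOn.isOpen_inter_preimage (fun y hy => ?_) hS isOpen_Ioi
      have hy0 : y ≠ 0 := norm_pos_iff.1 (hl.trans hy)
      exact (hw.cont.continuousAt.sub (continuousAt_kelvin hw.cont l hy0)).continuousWithinAt
    refine integral_pos_of_pos_on_open h1 hU ?_ z (fun y hyz => ?_) fun y hy hyz => ?_
    · obtain ⟨y, hy, hy2⟩ := hne
      exact ⟨y, hy, sub_pos.2 (lt_of_le_of_ne (hle y hy) hy2)⟩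
    · by_cases hy : y ∈ {y : E4 | l < ‖y‖}
      · rw [indicator_of_mem hy]
        have h3 := hle y hy
        have h0 := (hw.kelvin_pos hl (norm_pos_iff.1 (hl.trans hy))).le
        have h4 : kelvin l w y ^ 3 ≤ w y ^ 3 := by gcongr
        have := reflKernel_lt hl hz hy hyz
        exact mul_nonneg (by linarith) (by linarith)
      · rw [indicator_of_notMem hy]
    · rw [indicator_of_mem hy.1]
      have h3 : kelvin l w y < w y := sub_pos.1 hy.2
      have h0 := (hw.kelvin_pos hl (norm_pos_iff.1 (hl.trans hy.1))).le
      have h4 : kelvin l w y ^ 3 < w y ^ 3 := by gcongr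
      have := reflKernel_lt hl hz hy.1 hyz
      exact mul_pos (by linarith) (by linarith)
  have hk := kap_pos
  have h3 : 0 < kap * (w z - kelvin l w z) := by rw [h2]; positivity
  exact sub_pos.1 (pos_of_mul_pos_right h3 hk.le)

lemma IsSol.eventually_kelvin_le {w : E4 → ℝ} (hw : IsSol w) {l : ℝ} (hl : 0 < l)
    (hle : ∀ y, l < ‖y‖ → kelvin l w y ≤ w y) (hne : ∃ y, l < ‖y‖ ∧ kelvin l w y ≠ w y) :
    ∀ᶠ k in 𝓝 l, ∀ y, k < ‖y‖ → kelvin k w y ≤ w y := by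
  set I := ∫ y, decayKernel y with hI
  have hI0 : 0 ≤ I := integral_nonneg decayKernel_nonneg
  have hk := kap_pos
  set c := l + 1 with hc
  set s := min 1 (kap / (96 * c ^ 4 * (I + 1))) with hsdef
  have hs : 0 < s := lt_min one_pos (by positivity)
  have hs2 : s * (96 * c ^ 4 * (I + 1)) ≤ kap := by
    rw [← le_div_iff₀ (by positivity)]; exact min_le_right _ _
  have hlim : Tendsto (fun k => ∫ y, {y | k < ‖y‖ ∧ w y < kelvin k w y}.indicator decayKernel y)
      (𝓝 l) (𝓝 (∫ _ : E4, (0 : ℝ))) := by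
    refine tendsto_integral_filter_of_dominated_convergence decayKernel ?_ ?_
      integrable_decayKernel ?_
    · exact Eventually.of_forall fun k => (integrable_decayKernel.indicator
        (measurableSet_lt_kelvin k hw.cont)).aestronglyMeasurable
    · refine Eventually.of_forall fun k => Eventually.of_forall fun y => ?_
      rw [Real.norm_of_nonneg (indicator_nonneg (fun y _ => decayKernel_nonneg y) y)]
      exact indicator_le_self' (fun y _ => decayKernel_nonneg y) y
    · filter_upwards [compl_mem_ae_iff.2 (Measure.addHaar_sphere volume (0 : E4) l)] with y hy
      refine tendsto_const_nhds.congr' ?_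
      have hy' : ‖y‖ ≠ l := by simpa using hy
      rcases lt_or_gt_of_ne hy' with h | h
      · filter_upwards [eventually_gt_nhds h] with k hk
        rw [indicator_of_notMem]
        exact fun h2 => absurd h2.1 (not_lt.2 hk.le)
      · have h1 := hw.kelvin_lt hl hle hne h
        filter_upwards [(continuous_kelvin_radius hw.cont y).continuousAt.eventually_lt
          continuousAt_const h1] with k hk
        rw [indicator_of_notMem]
        exact fun h2 => absurd h2.2 (not_lt.2 hk.le)
  rw [integral_zero] at hlim
  have hlim2 := hlim.const_mul (48 * (c ^ 4 * (s ^ 2)⁻¹))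
  rw [mul_zero] at hlim2
  filter_upwards [hlim2.eventually_lt_const (half_pos hk), eventually_gt_nhds hl,
    eventually_lt_nhds (lt_add_one l)] with k h1 h2 h3
  refine hw.kelvin_le_of_near h2 h3.le (by linarith) hs (min_le_left _ _) ?_
  have h4 : 0 ≤ s * (96 * c ^ 4) := by positivity
  nlinarith

/-- Method of moving spheres: either all Kelvin transforms centred at the origin lie below `w`, or
one of them coincides with `w`. -/
lemma IsSol.moving_spheres {w : E4 → ℝ} (hw : IsSol w) :
    (∀ l, 0 < l → ∀ y, l < ‖y‖ → kelvin l w y ≤ w y) ∨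
      ∃ l, 0 < l ∧ ∀ y, y ≠ 0 → kelvin l w y = w y := by
  by_contra! hcon
  obtain ⟨⟨l, hl, y, hy, hly⟩, h2⟩ := hcon
  set A := {l | 0 < l ∧ ∀ y, l < ‖y‖ → kelvin l w y ≤ w y} with hA
  have hne : ∀ l, 0 < l → ∃ y, l < ‖y‖ ∧ kelvin l w y ≠ w y := by
    intro l hl
    by_contra! h
    obtain ⟨y, hy0, hy⟩ := h2 l hl
    have hn : 0 < ‖y‖ := norm_pos_iff.2 hy0
    rcases lt_trichotomy l ‖y‖ with h3 | h3 | h3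
    · exact hy (h y h3)
    · refine hy ?_
      simp [kelvin, sinv, h3, hn.ne']
    · have h4 : l < ‖sinv l y‖ := by
        rw [norm_sinv, lt_div_iff₀ hn, sq]
        exact mul_lt_mul_of_pos_left h3 hl
      have h5 := h _ h4
      rw [kelvin, sinv_sinv hl, norm_sinv] at h5
      refine hy ?_
      rw [kelvin, ← h5]
      field_simp
  have hopen : IsOpen A := by
    rw [isOpen_iff_eventually]
    rintro l ⟨hl, h⟩
    filter_upwards [hw.eventually_kelvin_le hl h (hne l hl), eventually_gt_nhds hl] with k h1 h2
    exact ⟨h2, h1⟩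
  have hcl : closure A ∩ Ioi 0 ⊆ A := by
    rintro l ⟨hl, hl0⟩
    refine ⟨hl0, fun y hy => ?_⟩
    by_contra! h
    rw [mem_closure_iff_frequently] at hl
    have h3 := continuousAt_const.eventually_lt
      (continuous_kelvin_radius hw.cont y).continuousAt h
    obtain ⟨k, hk, hk2, hk3⟩ := (hl.and_eventually (h3.and (eventually_lt_nhds hy))).exists
    exact absurd (hk.2 y hk3) (not_le.2 hk2)
  obtain ⟨k, hk⟩ := hw.exists_small
  have := isPreconnected_Ioi.subset_of_closure_inter_subset hopen ⟨k, hk.1, hk⟩ hcl hl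
  exact absurd (this.2 y hy) (not_le.2 hly)

lemma tendsto_norm_sq_mul_recenter {w : E4 → ℝ} {α : ℝ} (a b : E4)
    (h : Tendsto (fun y => ‖y - a‖ ^ 2 * w y) (Bornology.cobounded E4) (𝓝 α)) :
    Tendsto (fun y => ‖y - b‖ ^ 2 * w y) (Bornology.cobounded E4) (𝓝 α) := by
  have h0 : Tendsto (fun y : E4 => ‖y - a‖) (Bornology.cobounded E4) atTop := by
    simp_rw [← dist_eq_norm]
    exact tendsto_dist_right_cobounded_atTop a
  have h1 : Tendsto (fun y : E4 => ‖y - b‖ / ‖y - a‖) (Bornology.cobounded E4) (𝓝 1) := by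
    have h2 : Tendsto (fun y : E4 => ‖a - b‖ / ‖y - a‖) (Bornology.cobounded E4) (𝓝 0) :=
      h0.const_div_atTop _
    rw [tendsto_iff_norm_sub_tendsto_zero]
    refine squeeze_zero' (Eventually.of_forall fun y => norm_nonneg _) ?_ h2
    filter_upwards [h0.eventually_gt_atTop 0] with y hy
    rw [div_sub_one hy.ne', norm_div, norm_norm]
    gcongr
    refine (abs_norm_sub_norm_le _ _).trans_eq ?_
    congr 1
    abel
  have h3 := (h1.pow 2).mul h
  rw [one_pow, one_mul] at h3
  refine h3.congr' ?_
  filter_upwards [h0.eventually_gt_atTop 0] with y hy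
  field_simp

lemma tendsto_sinv_cobounded (l : ℝ) : Tendsto (sinv l) (Bornology.cobounded E4) (𝓝 0) := by
  rw [tendsto_zero_iff_norm_tendsto_zero]
  simp only [norm_sinv]
  exact tendsto_norm_cobounded_atTop.const_div_atTop _

lemma tendsto_of_kelvin_eq {w : E4 → ℝ} (hw : Continuous w) {x : E4} {l : ℝ}
    (h : ∀ y, y ≠ 0 → kelvin l (fun z => w (x + z)) y = w (x + y)) :
    Tendsto (fun y => ‖y - x‖ ^ 2 * w y) (Bornology.cobounded E4) (𝓝 (l ^ 2 * w x)) := by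
  have h0 : Tendsto (fun y : E4 => y - x) (Bornology.cobounded E4) (Bornology.cobounded E4) :=
    tendsto_sub_const_cobounded x
  have h1 : Tendsto (fun y : E4 => l ^ 2 * w (x + sinv l (y - x))) (Bornology.cobounded E4)
      (𝓝 (l ^ 2 * w (x + 0))) :=
    ((hw.tendsto _).comp (((tendsto_sinv_cobounded l).comp h0).const_add x)).const_mul _
  rw [add_zero] at h1
  refine h1.congr' ?_
  filter_upwards [(tendsto_norm_cobounded_atTop.comp h0).eventually_gt_atTop 0] with y hy
  have hy' : ‖y - x‖ ≠ 0 := ne_of_gt hy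
  have := h (y - x) (norm_ne_zero_iff.1 hy')
  rw [add_sub_cancel] at this
  rw [← this, kelvin]
  field_simp

lemma not_forall_kelvin_le_of_kelvin_eq {w : E4 → ℝ} (hw : IsSol w) {x x' : E4} {l : ℝ}
    (h : ∀ y, y ≠ 0 → kelvin l (fun z => w (x + z)) y = w (x + y)) :
    ¬ ∀ k, 0 < k → ∀ y, k < ‖y‖ → kelvin k (fun z => w (x' + z)) y ≤ w (x' + y) := by
  intro h'
  have h1 := tendsto_norm_sq_mul_recenter x x' (tendsto_of_kelvin_eq hw.cont h)
  have h2 : ∀ k, 0 < k → k ^ 2 * w x' ≤ l ^ 2 * w x := by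
    intro k hk
    have h0 : Tendsto (fun y : E4 => y - x') (Bornology.cobounded E4) (Bornology.cobounded E4) :=
      tendsto_sub_const_cobounded x'
    have h3 : Tendsto (fun y : E4 => k ^ 2 * w (x' + sinv k (y - x'))) (Bornology.cobounded E4)
        (𝓝 (k ^ 2 * w (x' + 0))) :=
      ((hw.cont.tendsto _).comp (((tendsto_sinv_cobounded k).comp h0).const_add x')).const_mul _
    rw [add_zero] at h3
    refine le_of_tendsto_of_tendsto h3 h1 ?_
    filter_upwards [(tendsto_norm_cobounded_atTop.comp h0).eventually_gt_atTop k] with y hy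
    have hy0 : 0 < ‖y - x'‖ := hk.trans hy
    have h4 := h' k hk (y - x') hy
    rw [add_sub_cancel, kelvin, div_pow, div_mul_eq_mul_div, div_le_iff₀ (by positivity)] at h4
    linarith
  have hx' := hw.pos x'
  have h3 := h2 (√(l ^ 2 * w x / w x' + 1)) (by have := hw.pos x; positivity)
  rw [Real.sq_sqrt (by have := hw.pos x; positivity), add_mul,
    div_mul_cancel₀ _ hx'.ne'] at h3
  linarith

lemma le_of_forall_kelvin_le {w : E4 → ℝ}
    (h : ∀ x k, 0 < k → ∀ y, k < ‖y‖ → kelvin k (fun z => w (x + z)) y ≤ w (x + y)) (a b : E4) :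
    w a ≤ w b := by
  rcases eq_or_ne a b with rfl | hab
  · rfl
  have hs : ∀ s ∈ Ioo (0 : ℝ) 1, s * w a ≤ w b := by
    rintro s ⟨hs0, hs1⟩
    have h1 : 1 - s ≠ 0 := by linarith
    set y := (1 - s)⁻¹ • (b - a) with hy
    have hy0 : 0 < ‖y‖ := norm_pos_iff.2 (smul_ne_zero (inv_ne_zero h1) (sub_ne_zero.2 hab.symm))
    have h2 : √s < 1 := by rw [Real.sqrt_lt' one_pos]; simpa using hs1
    have h3 := h (b - y) (√s * ‖y‖) (by positivity) y (by nlinarith)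
    have h4 : (√s * ‖y‖ / ‖y‖) ^ 2 = s := by
      rw [mul_div_cancel_right₀ _ hy0.ne', Real.sq_sqrt hs0.le]
    have h5 : b - y + s • y = a := by
      have : (1 - s) • y = b - a := by rw [hy, smul_inv_smul₀ h1]
      rw [sub_smul, one_smul] at this
      rw [sub_add, this, sub_sub_cancel]
    simpa only [kelvin, sinv, h4, h5, sub_add_cancel] using h3
  have h1 : Tendsto (fun s : ℝ => s * w a) (𝓝[<] 1) (𝓝 (1 * w a)) :=
    (tendsto_id.mono_left nhdsWithin_le_nhds).mul_const _
  rw [one_mul] at h1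
  refine le_of_tendsto h1 ?_
  filter_upwards [Ioo_mem_nhdsLT (zero_lt_one' ℝ)] with s hs' using hs s hs'

lemma IsSol.not_const {w : E4 → ℝ} (hw : IsSol w) : ¬ ∀ a b, w a = w b := by
  intro h
  have h1 : ∫ y : E4, (‖(2 : ℝ) • y‖ ^ 2)⁻¹ = (4 : ℝ)⁻¹ * ∫ y : E4, (‖y‖ ^ 2)⁻¹ := by
    rw [← integral_const_mul]
    congr 1
    ext y
    rw [norm_smul, mul_pow, mul_inv]
    norm_num
  rw [Measure.integral_comp_smul volume (fun y : E4 => (‖y‖ ^ 2)⁻¹), finrank_E4, smul_eq_mul] at h1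
  have h2 : ∫ y : E4, (‖y‖ ^ 2)⁻¹ = 0 := by
    norm_num at h1
    linarith
  have h3 := hw.eqn 0
  simp only [h _ 0, dist_zero_left] at h3
  rw [integral_const_mul, h2] at h3
  have := mul_pos kap_pos (hw.pos 0)
  linarith

theorem IsSol.exists_kelvin_eq {w : E4 → ℝ} (hw : IsSol w) :
    ∃ α, 0 < α ∧ ∀ x, ∃ l, 0 < l ∧ l ^ 2 * w x = α ∧
      ∀ y, y ≠ 0 → kelvin l (fun z => w (x + z)) y = w (x + y) := by
  obtain ⟨x', l', hl', h'⟩ : ∃ x l, 0 < l ∧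
      ∀ y, y ≠ 0 → kelvin l (fun z => w (x + z)) y = w (x + y) := by
    by_contra! hcon
    have h1 : ∀ x k, 0 < k → ∀ y, k < ‖y‖ → kelvin k (fun z => w (x + z)) y ≤ w (x + y) := by
      intro x
      rcases (hw.translate x).moving_spheres with h | ⟨l, hl, h⟩
      · exact h
      · obtain ⟨y, hy, hy2⟩ := hcon x l hl
        exact absurd (h y hy) hy2
    exact hw.not_const fun a b =>
      le_antisymm (le_of_forall_kelvin_le h1 a b) (le_of_forall_kelvin_le h1 b a)
  refine ⟨l' ^ 2 * w x', mul_pos (by positivity) (hw.pos _), fun x => ?_⟩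
  rcases (hw.translate x).moving_spheres with h | ⟨l, hl, h⟩
  · exact absurd h (not_forall_kelvin_le_of_kelvin_eq hw h')
  · exact ⟨l, hl, tendsto_nhds_unique
      (tendsto_norm_sq_mul_recenter x x' (tendsto_of_kelvin_eq hw.cont h))
      (tendsto_of_kelvin_eq hw.cont h'), h⟩

lemma const_of_abs_sub_le_norm_sq {G : E4 → ℝ} {C : ℝ}
    (h : ∀ x y, |G (x + y) - G x| ≤ C * ‖y‖ ^ 2) (x y : E4) : G x = G y := by
  have h1 : ∀ x, HasFDerivAt G (0 : E4 →L[ℝ] ℝ) x := by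
    intro x
    have h2 : (fun y => G y - G x) =O[𝓝 x] fun y => ‖y - x‖ ^ 2 := by
      refine Asymptotics.IsBigO.of_bound C (Eventually.of_forall fun y => ?_)
      have := h x (y - x)
      rw [add_sub_cancel] at this
      simpa using this
    have h3 := h2.hasFDerivAt (𝕜 := ℝ) one_lt_two
    simpa using h3.add_const (G x)
  exact is_const_of_fderiv_eq_zero (𝕜 := ℝ) (fun x => (h1 x).differentiableAt)
    (fun x => (h1 x).fderiv) x y

lemma IsSol.eq_of_at_zero {w : E4 → ℝ} (hw : IsSol w) (h0 : w 0 = 1) :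
    ∃ α, 0 < α ∧ ∀ x, w x = (1 + ‖x‖ ^ 2 / α)⁻¹ := by
  obtain ⟨α, hα, h⟩ := hw.exists_kelvin_eq
  refine ⟨α, hα, ?_⟩
  have hkey : ∀ x y, y ≠ 0 →
      w (x + y) = α / (w x * ‖y‖ ^ 2) * w (x + (α / (w x * ‖y‖ ^ 2)) • y) := by
    intro x y hy
    obtain ⟨l, hl, hlα, hx⟩ := h x
    have hwx := hw.pos x
    have h1 : (l / ‖y‖) ^ 2 = α / (w x * ‖y‖ ^ 2) := by
      rw [div_pow, ← hlα, mul_comm (w x), mul_div_mul_right _ _ hwx.ne']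
    rw [← hx y hy, kelvin, sinv, h1]
  have hup : ∀ y, ‖y‖ ^ 2 * w y ≤ α := by
    intro y
    rcases eq_or_ne y 0 with rfl | hy
    · simpa using hα.le
    have hn : 0 < ‖y‖ := norm_pos_iff.2 hy
    have h1 := hkey 0 y hy
    rw [zero_add, h0, one_mul] at h1
    have h2 := hw.le_one (0 + (α / ‖y‖ ^ 2) • y)
    rw [h1]
    calc ‖y‖ ^ 2 * (α / ‖y‖ ^ 2 * w (0 + (α / ‖y‖ ^ 2) • y))
        = α * w (0 + (α / ‖y‖ ^ 2) • y) := by field_simp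
      _ ≤ α * 1 := by gcongr
      _ = α := mul_one α
  have hlow : ∀ x y, (w x)⁻¹ - ‖x‖ ^ 2 / α - ‖y‖ ^ 2 / α ≤
      (w (x + y))⁻¹ - ‖x + y‖ ^ 2 / α := by
    intro x y
    rcases eq_or_ne y 0 with rfl | hy
    · simp
    have hn : 0 < ‖y‖ := norm_pos_iff.2 hy
    have hwx := hw.pos x
    have hwy := hw.pos (x + y)
    have h1 := hkey x y hy
    set t := α / (w x * ‖y‖ ^ 2) with ht
    have ht0 : 0 < t := by positivity
    have h2 := hup (x + t • y)
    have h3 : w (x + t • y) = w (x + y) / t := by rw [h1]; field_simp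
    rw [h3, norm_add_sq_real, norm_smul, inner_smul_right, Real.norm_of_nonneg ht0.le] at h2
    rw [norm_add_sq_real]
    have h4 : ‖x‖ ^ 2 / t + 2 * inner ℝ x y + t * ‖y‖ ^ 2 ≤ α * (w (x + y))⁻¹ := by
      rw [← div_eq_mul_inv, le_div_iff₀ hwy]
      refine le_trans (le_of_eq ?_) h2
      field_simp
    have h5 : t * ‖y‖ ^ 2 = α * (w x)⁻¹ := by
      rw [ht]; field_simp
    have h6 : 0 ≤ ‖x‖ ^ 2 / t := by positivity
    have h7 : α * ((w x)⁻¹ - ‖x‖ ^ 2 / α - ‖y‖ ^ 2 / α) ≤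
      α * ((w (x + y))⁻¹ - (‖x‖ ^ 2 + 2 * inner ℝ x y + ‖y‖ ^ 2) / α) := by
      have e1 : α * ((w x)⁻¹ - ‖x‖ ^ 2 / α - ‖y‖ ^ 2 / α) =
        α * (w x)⁻¹ - ‖x‖ ^ 2 - ‖y‖ ^ 2 := by field_simp
      have e2 : α * ((w (x + y))⁻¹ - (‖x‖ ^ 2 + 2 * inner ℝ x y + ‖y‖ ^ 2) / α) =
        α * (w (x + y))⁻¹ - (‖x‖ ^ 2 + 2 * inner ℝ x y + ‖y‖ ^ 2) := by field_simp
      rw [e1, e2]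
      linarith
    exact le_of_mul_le_mul_left h7 hα
  intro x
  have h1 := const_of_abs_sub_le_norm_sq (G := fun x => (w x)⁻¹ - ‖x‖ ^ 2 / α) (C := α⁻¹)
    (fun x y => by
      have h1 := hlow x y
      have h2 := hlow (x + y) (-y)
      rw [norm_neg, add_neg_cancel_right] at h2
      rw [inv_mul_eq_div, abs_le]
      constructor <;> linarith) x 0
  simp only [h0, norm_zero] at h1
  rw [← inv_inv (w x)]
  congr 1
  norm_num at h1
  linarith

/-- Classification of the solutions normalized at their maximum. -/
theorem IsSol.eq_bubble {w : E4 → ℝ} (hw : IsSol w) (h0 : w 0 = 1) (x : E4) :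
    w x = (1 + ‖x‖ ^ 2)⁻¹ := by
  obtain ⟨α, hα, h⟩ := hw.eq_of_at_zero h0
  suffices hα1 : α = 1 by rw [h, hα1, div_one]
  have hs : 0 < √α := Real.sqrt_pos.2 hα
  have hs2 : √α ^ 2 = α := Real.sq_sqrt hα.le
  set F : E4 → ℝ := fun y => w y ^ 3 * (‖y‖ ^ 2)⁻¹ with hF
  have h1 := Measure.integral_comp_smul volume F (√α)
  rw [finrank_E4, smul_eq_mul, show √α ^ 4 = α ^ 2 by rw [← hs2, Real.sqrt_sq hs.le]; ring,
    abs_of_pos (by positivity)] at h1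
  have h2 : ∀ y : E4, F (√α • y) = α⁻¹ * ((1 + ‖y‖ ^ 2)⁻¹ ^ 3 * (‖y‖ ^ 2)⁻¹) := by
    intro y
    simp only [hF, h]
    rw [norm_smul, Real.norm_of_nonneg hs.le, mul_pow, hs2, mul_div_cancel_left₀ _ hα.ne', mul_inv]
    ring
  simp only [h2] at h1
  rw [integral_const_mul] at h1
  have h3 := hw.eqn 0
  have h4 := isSol_bubble.eqn 0
  simp only [dist_zero_left, h0, norm_zero] at h3 h4
  have h5 : kap = kap * α := by
    have : α⁻¹ * (kap / 8) = (α ^ 2)⁻¹ * (kap / 8) := by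
      rw [show kap / 8 = ∫ y : E4, (1 + ‖y‖ ^ 2)⁻¹ ^ 3 * (‖y‖ ^ 2)⁻¹ by
        norm_num at h4 ⊢; linarith, h1]
      congr 1
      norm_num at h4 h3 ⊢
      simp only [hF]
      linarith
    have hk := kap_pos
    field_simp at this
    nlinarith
  have := kap_pos
  have h6 : kap * (α - 1) = 0 := by linarith
  have := (mul_eq_zero.1 h6).resolve_left this.ne'
  linarith

/-- Selection of a blow-up point together with a ball of controlled size around it. -/
lemma exists_blowup_point {x₀ : E4} {r₀ R c : ℝ} {u : E4 → ℝ} (hu : ContinuousOn u (ball x₀ r₀))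
    (hpos : ∀ x ∈ ball x₀ r₀, 0 < u x) (hR : 0 < R) (hRr : 4 * R < r₀)
    (hlower : c ≤ R ^ 2 * (sSup (u '' ball x₀ R)) ^ ((1 : ℝ) / 3) *
      sInf (u '' ball x₀ (2 * R))) :
    ∃ y d, 0 < d ∧ d ≤ R ∧ dist y x₀ + d < 2 * R ∧
      sInf (u '' ball x₀ (2 * R)) ≤ u y ∧
      c / 2 ≤ d ^ 2 * u y ^ ((1 : ℝ) / 3) * sInf (u '' ball x₀ (2 * R)) ∧
      ∀ ε, ε < 1 → ∀ x, dist x y ≤ ε * d → u x ≤ ((1 - ε) ^ 6)⁻¹ * u y := by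
  have hsub : ball x₀ (2 * R) ⊆ ball x₀ r₀ := ball_subset_ball (by linarith)
  set m := sInf (u '' ball x₀ (2 * R)) with hm
  have hm0 : 0 ≤ m := Real.sInf_nonneg (by
    rintro _ ⟨x, hx, rfl⟩
    exact (hpos x (hsub hx)).le)
  have hmle : ∀ x ∈ ball x₀ (2 * R), m ≤ u x := fun x hx =>
    csInf_le ⟨0, by
      rintro _ ⟨x, hx, rfl⟩
      exact (hpos x (hsub hx)).le⟩ (mem_image_of_mem u hx)
  set S := sSup (u '' ball x₀ R) with hS
  have hne : (u '' ball x₀ R).Nonempty := (nonempty_ball.2 hR).image u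
  have hbdd : BddAbove (u '' ball x₀ R) :=
    ((isCompact_closedBall x₀ R).image_of_continuousOn (hu.mono
      (closedBall_subset_ball (by linarith)))).bddAbove.mono (image_mono ball_subset_closedBall)
  have hx0 : x₀ ∈ ball x₀ R := mem_ball_self hR
  have hS0 : 0 < S := (hpos x₀ (mem_ball_self (by linarith))).trans_le
    (le_csSup hbdd (mem_image_of_mem u hx0))
  obtain ⟨_, ⟨a, ha, rfl⟩, haS⟩ := exists_lt_of_lt_csSup hne (show S / 8 < S by linarith)
  rw [mem_ball] at ha
  have hKsub : closedBall a R ⊆ ball x₀ (2 * R) := fun x hx => by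
    rw [mem_closedBall] at hx
    rw [mem_ball]
    linarith [dist_triangle x a x₀]
  obtain ⟨y, hy, hmax⟩ := (isCompact_closedBall a R).exists_isMaxOn
    (f := fun x => (R - dist x a) ^ 6 * u x) ⟨a, mem_closedBall_self hR.le⟩
    ((by fun_prop : Continuous fun x => (R - dist x a) ^ 6).continuousOn.mul
      (hu.mono (hKsub.trans hsub)))
  have hyM : 0 < u y := hpos y (hsub (hKsub hy))
  have hua : 0 < u a := hpos a (hsub (hKsub (mem_closedBall_self hR.le)))
  have h1 : R ^ 6 * u a ≤ (R - dist y a) ^ 6 * u y := by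
    simpa using hmax (mem_closedBall_self hR.le)
  rw [mem_closedBall] at hy
  have hd : 0 < R - dist y a := by
    refine lt_of_le_of_ne (by linarith) fun h => ?_
    rw [← h] at h1
    have : 0 < R ^ 6 * u a := by positivity
    norm_num at h1
    linarith
  set d := R - dist y a with hddef
  refine ⟨y, d, hd, by linarith [dist_nonneg (x := y) (y := a)], ?_, hmle y (hKsub hy), ?_, ?_⟩
  · linarith [dist_triangle y a x₀]
  · have h2 : ∀ {t : ℝ} (v : ℝ), 0 < t → 0 ≤ v →
        (t ^ 6 * v) ^ ((1 : ℝ) / 3) = t ^ 2 * v ^ ((1 : ℝ) / 3) := by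
      intro t v ht hv
      rw [Real.mul_rpow (by positivity) hv, ← Real.rpow_natCast, ← Real.rpow_mul ht.le]
      norm_num
    have h3 : R ^ 2 * u a ^ ((1 : ℝ) / 3) ≤ d ^ 2 * u y ^ ((1 : ℝ) / 3) := by
      rw [← h2 _ hR hua.le, ← h2 _ hd hyM.le]
      exact Real.rpow_le_rpow (by positivity) h1 (by norm_num)
    have h4 : S ^ ((1 : ℝ) / 3) / 2 ≤ u a ^ ((1 : ℝ) / 3) := by
      have h5 : (S / 8) ^ ((1 : ℝ) / 3) = S ^ ((1 : ℝ) / 3) / 2 := by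
        rw [Real.div_rpow hS0.le (by norm_num), show (8 : ℝ) = 2 ^ (3 : ℝ) by norm_num,
          ← Real.rpow_mul (by norm_num)]
        norm_num
      rw [← h5]
      exact Real.rpow_le_rpow (by positivity) haS.le (by norm_num)
    calc c / 2 ≤ R ^ 2 * (S ^ ((1 : ℝ) / 3) / 2) * m := by linarith
      _ ≤ R ^ 2 * u a ^ ((1 : ℝ) / 3) * m := by gcongr
      _ ≤ _ := by gcongr
  · intro ε hε x hx
    have h2 : (1 - ε) * d ≤ R - dist x a := by
      linarith [dist_triangle x y a]
    have h3 : 0 < (1 - ε) * d := mul_pos (by linarith) hd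
    have hxK : x ∈ closedBall a R := by rw [mem_closedBall]; linarith
    have h4 : (R - dist x a) ^ 6 * u x ≤ d ^ 6 * u y := hmax hxK
    have hux : 0 < u x := hpos x (hsub (hKsub hxK))
    have h5 : ((1 - ε) * d) ^ 6 * u x ≤ d ^ 6 * u y := le_trans (by gcongr) h4
    have hε' : 0 < 1 - ε := by linarith
    rw [inv_mul_eq_div, le_div_iff₀ (by positivity)]
    refine le_of_mul_le_mul_left (le_trans (le_of_eq ?_) h5) (by positivity : 0 < d ^ 6)
    ring

lemma tendsto_sqrt_div_two {c : ℕ → ℝ} (hc : Tendsto c atTop atTop) :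
    Tendsto (fun i => √(c i) / 2) atTop atTop :=
  (Real.tendsto_sqrt_atTop.comp hc).atTop_div_const two_pos

lemma one_le_of_blowup {M m d c : ℝ} (hM : 0 < M) (hm : m ≤ M) (hd : 0 < d)
    (hd1 : d ≤ 1) (hc : 2 ≤ c) (h : c / 2 ≤ d ^ 2 * M ^ ((1 : ℝ) / 3) * m) :
    1 ≤ M ∧ c / 2 ≤ (d * M) ^ 2 := by
  have h0 : 0 < M ^ ((1 : ℝ) / 3) := Real.rpow_pos_of_pos hM _
  have h1 : c / 2 ≤ d ^ 2 * M ^ ((1 : ℝ) / 3) * M := h.trans (by gcongr)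
  have hM1 : 1 ≤ M := by
    by_contra! hlt
    have h2 : M ^ ((1 : ℝ) / 3) ≤ 1 := Real.rpow_le_one hM.le hlt.le (by norm_num)
    have h3 : d ^ 2 * M ^ ((1 : ℝ) / 3) * M ≤ 1 ^ 2 * 1 * M := by gcongr
    linarith
  refine ⟨hM1, h1.trans ?_⟩
  have h2 : M ^ ((1 : ℝ) / 3) ≤ M := by
    conv_rhs => rw [← Real.rpow_one M]
    exact Real.rpow_le_rpow_of_exponent_le hM1 (by norm_num)
  calc d ^ 2 * M ^ ((1 : ℝ) / 3) * M ≤ d ^ 2 * M * M := by gcongr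
    _ = _ := by ring

lemma contDiffOn_rescale {u : E4 → ℝ} {x₀ y : E4} {r M L : ℝ} (hu : ContDiffOn ℝ 2 u (ball x₀ r))
    (hmaps : ∀ z ∈ ball (0 : E4) L, y + M⁻¹ • z ∈ ball x₀ r) :
    ContDiffOn ℝ 2 (fun z => M⁻¹ * u (y + M⁻¹ • z)) (ball 0 L) := by
  have h1 : ContDiff ℝ 2 fun z : E4 => y + M⁻¹ • z := by fun_prop
  exact contDiffOn_const.mul (hu.comp h1.contDiffOn hmaps)

lemma blow_up_of_bounds {x₀ : E4} {r₀ A : ℝ} {u h : ℕ → E4 → ℝ}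
    (hu2 : ∀ i, ContDiffOn ℝ 2 (u i) (ball x₀ r₀))
    (hupos : ∀ i, ∀ x ∈ ball x₀ r₀, 0 < u i x)
    (hh : ∀ i, ∀ x ∈ ball x₀ r₀, |h i x| ≤ A)
    (heq : ∀ i, ∀ x ∈ ball x₀ r₀, -lap (u i) x + h i x * u i x = 8 * (u i x) ^ 3)
    {R c : ℕ → ℝ} (hRpos : ∀ i, 0 < R i) (hR1 : ∀ i, R i ≤ 1) (hc16 : ∀ i, 16 ≤ c i)
    (hR0 : Tendsto R atTop (𝓝 0)) (hc : Tendsto c atTop atTop)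
    (hRr : ∀ i, 4 * R i < r₀)
    (hlower : ∀ i, c i ≤
      (R i) ^ 2 * (sSup (u i '' ball x₀ (R i))) ^ ((1 : ℝ) / 3) *
        sInf (u i '' ball x₀ (2 * R i))) :
    ∃ φ : ℕ → ℕ, StrictMono φ ∧
      ∃ y : ℕ → E4, ∃ l L β : ℕ → ℝ,
        Tendsto y atTop (𝓝 x₀) ∧
        (∀ i, 0 < l i) ∧ Tendsto l atTop (𝓝 0) ∧
        (∀ i, 0 < L i) ∧ Tendsto L atTop atTop ∧
        Tendsto β atTop (𝓝 1) ∧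
        (∀ i, ∀ z : E4, ‖z‖ ≤ L i →
          0 < u (φ i) (y i + (u (φ i) (y i))⁻¹ • z) / u (φ i) (y i) ∧
          u (φ i) (y i + (u (φ i) (y i))⁻¹ • z) / u (φ i) (y i) ≤ β i) ∧
        (∀ C : Set E4, IsCompact C →
          TendstoUniformlyOn
            (fun i z => u (φ i) (y i + (u (φ i) (y i))⁻¹ • z) / u (φ i) (y i))
            (fun z => 1 / (1 + ‖z‖ ^ 2)) atTop C) ∧
        Tendsto (fun i =>
            (l i) ^ 2 * (u (φ i) (y i)) ^ ((1 : ℝ) / 3) *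
              sInf (u (φ i) '' ball x₀ (2 * R (φ i))))
          atTop atTop := by
  choose y d hd hdR hyd hmM hlow hbd using fun i =>
    exists_blowup_point (hu2 i).continuousOn (hupos i) (hRpos i) (hRr i) (hlower i)
  set ε : ℕ → ℝ := fun i => (√√(c i))⁻¹ with hε
  have hsc : ∀ i, 4 ≤ √(c i) := fun i => Real.le_sqrt_of_sq_le (by linarith [hc16 i])
  have hssc : ∀ i, 2 ≤ √√(c i) := fun i => Real.le_sqrt_of_sq_le (by linarith [hsc i])
  have hε0 : ∀ i, 0 < ε i := fun i => inv_pos.2 (by linarith [hssc i])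
  have hε1 : ∀ i, ε i ≤ 1 / 2 := fun i => by
    rw [one_div]
    exact inv_anti₀ two_pos (hssc i)
  have hε2 : ∀ i, ε i ^ 2 * (c i / 2) = √(c i) / 2 := fun i => by
    have h1 := hsc i
    have h2 : √(c i) ^ 2 = c i := Real.sq_sqrt (by linarith [hc16 i])
    have h3 : ε i ^ 2 = (√(c i))⁻¹ := by
      rw [hε]
      simp only [inv_pow]
      rw [Real.sq_sqrt (by linarith)]
    rw [h3]
    nth_rw 2 [← h2]
    field_simp
  have hεlim : Tendsto ε atTop (𝓝 0) :=
    tendsto_inv_atTop_zero.comp (Real.tendsto_sqrt_atTop.comp (Real.tendsto_sqrt_atTop.comp hc))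
  set M : ℕ → ℝ := fun i => u i (y i) with hMdef
  have hin : ∀ i x, dist x (y i) ≤ d i → x ∈ ball x₀ r₀ := fun i x hx => by
    rw [mem_ball]
    linarith [dist_triangle x (y i) x₀, hyd i, hRr i, hRpos i]
  have hM0 : ∀ i, 0 < M i := fun i =>
    hupos i _ (hin i _ (by rw [dist_self]; exact (hd i).le))
  have hM : ∀ i, 1 ≤ M i ∧ c i / 2 ≤ (d i * M i) ^ 2 := fun i =>
    one_le_of_blowup (hM0 i) (hmM i) (hd i) ((hdR i).trans (hR1 i)) (by linarith [hc16 i]) (hlow i)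
  have hcM : ∀ i, c i / 2 ≤ M i ^ 2 := fun i => (hM i).2.trans (by
    have h1 := (hdR i).trans (hR1 i)
    have h2 := hd i
    have h3 := hM0 i
    calc (d i * M i) ^ 2 ≤ (1 * M i) ^ 2 := by gcongr
      _ = _ := by rw [one_mul])
  set l : ℕ → ℝ := fun i => ε i * d i with hl
  have hl0 : ∀ i, 0 < l i := fun i => mul_pos (hε0 i) (hd i)
  have hld : ∀ i, l i ≤ d i := fun i => by
    have := hd i
    have := hε1 i
    simp only [hl]
    nlinarith
  set L : ℕ → ℝ := fun i => l i * M i with hL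
  have hL0 : ∀ i, 0 < L i := fun i => mul_pos (hl0 i) (hM0 i)
  have hhalf := tendsto_sqrt_div_two hc
  have hLlim : Tendsto L atTop atTop := by
    refine tendsto_atTop_mono (fun i => ?_) (Real.tendsto_sqrt_atTop.comp hhalf)
    refine Real.sqrt_le_iff.2 ⟨(hL0 i).le, ?_⟩
    beta_reduce
    rw [← hε2 i, show L i ^ 2 = ε i ^ 2 * (d i * M i) ^ 2 by simp only [hL, hl]; ring]
    have := (hM i).2
    gcongr
  set β : ℕ → ℝ := fun i => ((1 - ε i) ^ 6)⁻¹ with hβ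
  have hβlim : Tendsto β atTop (𝓝 1) := by
    have h1 := ((hεlim.const_sub 1).pow 6).inv₀ (by norm_num)
    simpa using h1
  have hlim0 : Tendsto l atTop (𝓝 0) :=
    squeeze_zero (fun i => (hl0 i).le) (fun i => (hld i).trans (hdR i)) hR0
  have hylim : Tendsto y atTop (𝓝 x₀) := by
    rw [tendsto_iff_dist_tendsto_zero]
    refine squeeze_zero (fun i => dist_nonneg) (fun i => ?_)
      (by simpa using hR0.const_mul 2 : Tendsto (fun i => 2 * R i) atTop (𝓝 0))
    linarith [hyd i, hd i]
  have hdist : ∀ i (z : E4), ‖z‖ ≤ L i → dist (y i + (M i)⁻¹ • z) (y i) ≤ l i := by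
    intro i z hz
    have h1 := hM0 i
    rw [dist_eq_norm, add_sub_cancel_left, norm_smul, norm_inv, Real.norm_of_nonneg h1.le,
      inv_mul_le_iff₀ h1, mul_comm]
    exact hz
  have hmem : ∀ i (z : E4), ‖z‖ ≤ L i → y i + (M i)⁻¹ • z ∈ ball x₀ r₀ := fun i z hz =>
    hin i _ ((hdist i z hz).trans (hld i))
  set v : ℕ → E4 → ℝ := fun i z => (M i)⁻¹ * u i (y i + (M i)⁻¹ • z) with hv
  have hvpos : ∀ i z, ‖z‖ ≤ L i → 0 < v i z := fun i z hz =>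
    mul_pos (inv_pos.2 (hM0 i)) (hupos i _ (hmem i z hz))
  have hvle : ∀ i z, ‖z‖ ≤ L i → v i z ≤ β i := fun i z hz => by
    have h1 := hbd i (ε i) (by linarith [hε1 i]) _ (hdist i z hz)
    simp only [hv]
    rw [inv_mul_le_iff₀ (hM0 i), mul_comm]
    exact h1
  have hball : ∀ i, ∀ z ∈ ball (0 : E4) (L i), ‖z‖ ≤ L i := fun i z hz =>
    (mem_ball_zero_iff.1 hz).le
  have hAlim : Tendsto (fun i => A / M i ^ 2) atTop (𝓝 0) :=
    (tendsto_atTop_mono hcM (hc.atTop_div_const two_pos)).const_div_atTop A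
  obtain ⟨φ, hφ, w, hwc, hw0, hw1, hw00, hweq, hwlim⟩ := exists_subseq_limit
    (v := v) (a := fun i z => h i (y i + (M i)⁻¹ • z) / M i ^ 2) hLlim hβlim hAlim
    (fun i => contDiffOn_rescale (hu2 i) fun z hz => hmem i z (hball i z hz))
    (fun i z hz => hvpos i z (hball i z hz)) (fun i z hz => hvle i z (hball i z hz))
    (fun i => by simp only [hv, smul_zero, add_zero]; exact inv_mul_cancel₀ (hM0 i).ne')
    (fun i z hz => by
      rw [abs_div, abs_of_pos (by have := hM0 i; positivity : 0 < M i ^ 2)]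
      gcongr
      exact hh i _ (hmem i z (hball i z hz)))
    (fun i z hz => by
      have h1 := heq i _ (hmem i z (hball i z hz))
      have h2 := (hM0 i).ne'
      simp only [hv]
      rw [lap_comp_affine]
      calc _ = (M i)⁻¹ ^ 3 * (-lap (u i) (y i + (M i)⁻¹ • z) +
            h i (y i + (M i)⁻¹ • z) * u i (y i + (M i)⁻¹ • z)) := by
            rw [div_eq_mul_inv, ← inv_pow]; ring
        _ = _ := by rw [h1]; ring)
  have hsol : IsSol w := IsLocalSol.isSol ⟨hwc, hw0, hw1, hw00, hweq⟩
  have hvdiv : ∀ i z, v i z = u i (y i + (u i (y i))⁻¹ • z) / u i (y i) := fun i z =>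
    inv_mul_eq_div _ _
  have hφt := hφ.tendsto_atTop
  refine ⟨φ, hφ, y ∘ φ, l ∘ φ, L ∘ φ, β ∘ φ, hylim.comp hφt, fun i => hl0 _, hlim0.comp hφt,
    fun i => hL0 _, hLlim.comp hφt, hβlim.comp hφt, fun i z hz => ?_, fun C hC => ?_, ?_⟩
  · simp only [Function.comp_apply, ← hvdiv]
    exact ⟨hvpos _ _ hz, hvle _ _ hz⟩
  · simp only [Function.comp_apply, ← hvdiv, one_div]
    rw [← funext fun x => hsol.eq_bubble hw00 x]
    exact hwlim C hC
  · have h1 : Tendsto (fun i => l i ^ 2 * M i ^ ((1 : ℝ) / 3) *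
        sInf (u i '' ball x₀ (2 * R i))) atTop atTop := by
      refine tendsto_atTop_mono (fun i => ?_) hhalf
      rw [← hε2 i]
      calc ε i ^ 2 * (c i / 2) ≤ ε i ^ 2 * (d i ^ 2 * M i ^ ((1 : ℝ) / 3) *
            sInf (u i '' ball x₀ (2 * R i))) := by
            have := hlow i
            gcongr
        _ = _ := by simp only [hl]; ring
    exact h1.comp hφt

end

/-- Proposition 2.1 of the paper (blow-up analysis, flat case): under the negation of the
sup × inf bound, after passing to a subsequence there is a blow-up sequence whose rescalings
converge to the standard bubble `1/(1+|z|²)`. -/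
theorem blow_up_analysis (x₀ : EuclideanSpace ℝ (Fin 4)) (r₀ A : ℝ)
    (hr₀ : 0 < r₀) (hA : 0 < A)
    (u h : ℕ → EuclideanSpace ℝ (Fin 4) → ℝ)
    (hu2 : ∀ i, ContDiffOn ℝ 2 (u i) (ball x₀ r₀))
    (hupos : ∀ i, ∀ x ∈ ball x₀ r₀, 0 < u i x)
    (hh : ∀ i, ∀ x ∈ ball x₀ r₀, |h i x| ≤ A)
    (heq : ∀ i, ∀ x ∈ ball x₀ r₀, -lap (u i) x + h i x * u i x = 8 * (u i x) ^ 3)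
    (R c : ℕ → ℝ) (hRpos : ∀ i, 0 < R i)
    (hR0 : Tendsto R atTop (nhds 0)) (hc : Tendsto c atTop atTop)
    (hRr : ∀ i, 4 * R i < r₀)
    (hlower : ∀ i, c i ≤
      (R i) ^ 2 * (sSup (u i '' ball x₀ (R i))) ^ ((1 : ℝ) / 3) *
        sInf (u i '' ball x₀ (2 * R i))) :
    ∃ φ : ℕ → ℕ, StrictMono φ ∧
      ∃ y : ℕ → EuclideanSpace ℝ (Fin 4), ∃ l L β : ℕ → ℝ,
        Tendsto y atTop (nhds x₀) ∧
        (∀ i, 0 < l i) ∧ Tendsto l atTop (nhds 0) ∧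
        (∀ i, 0 < L i) ∧ Tendsto L atTop atTop ∧
        Tendsto β atTop (nhds 1) ∧
        (∀ i, ∀ z : EuclideanSpace ℝ (Fin 4), ‖z‖ ≤ L i →
          0 < u (φ i) (y i + (u (φ i) (y i))⁻¹ • z) / u (φ i) (y i) ∧
          u (φ i) (y i + (u (φ i) (y i))⁻¹ • z) / u (φ i) (y i) ≤ β i) ∧
        (∀ C : Set (EuclideanSpace ℝ (Fin 4)), IsCompact C →
          TendstoUniformlyOn
            (fun i z => u (φ i) (y i + (u (φ i) (y i))⁻¹ • z) / u (φ i) (y i))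
            (fun z => 1 / (1 + ‖z‖ ^ 2)) atTop C) ∧
        Tendsto (fun i =>
            (l i) ^ 2 * (u (φ i) (y i)) ^ ((1 : ℝ) / 3) *
              sInf (u (φ i) '' ball x₀ (2 * R (φ i))))
          atTop atTop := by
  obtain ⟨N, hN⟩ := eventually_atTop.1
    ((hc.eventually_ge_atTop 16).and (hR0.eventually_le_const one_pos))
  obtain ⟨φ, hφ, h'⟩ := blow_up_of_bounds (u := fun i => u (i + N)) (h := fun i => h (i + N))
    (R := fun i => R (i + N)) (c := fun i => c (i + N)) (fun i => hu2 _) (fun i => hupos _)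
    (fun i => hh _) (fun i => heq _) (fun i => hRpos _)
    (fun i => (hN _ (Nat.le_add_left N i)).2) (fun i => (hN _ (Nat.le_add_left N i)).1)
    ((tendsto_add_atTop_iff_nat N).2 hR0) ((tendsto_add_atTop_iff_nat N).2 hc)
    (fun i => hRr _) (fun i => hlower _)
  exact ⟨fun i => φ i + N, fun i j hij => Nat.add_lt_add_right (hφ hij) N, h'⟩
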